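/- arXiv:1303.7313 — 3 statements merged into one kernel-verified Lean document; each statement's English description precedes it below -/
import Mathlib

section
/- Let a ∈ (0,1), c ∈ ℝ with c ≠ 0, and α ∈ (0, 1/2). Then lim_{n→∞} n^{3/2 − 2α} · P_n(⌊an − c·n^α⌋, ⌊(1−a)n − c·n^α⌋) / C_n = c² / (√π · (a(1−a))^{3/2}). -/
open Filter Finset Real
/-- `σ` contains the pattern `τ`. -/
def ContainsPattern {n m : ℕ} (σ : Equiv.Perm (Fin n)) (τ : Equiv.Perm (Fin m)) : Prop :=
  ∃ f : Fin m → Fin n, StrictMono f ∧ ∀ a b : Fin m, σ (f a) < σ (f b) ↔ τ a < τ b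

/-- `σ` avoids the pattern `τ`. -/
def Avoids {n m : ℕ} (σ : Equiv.Perm (Fin n)) (τ : Equiv.Perm (Fin m)) : Prop :=
  ¬ ContainsPattern σ τ

/-- The pattern (1,2,3) ∈ S₃ (0-indexed: 0,1,2). -/
def pattern123 : Equiv.Perm (Fin 3) := 1

/-- The pattern (1,3,2) ∈ S₃ (0-indexed: 0,2,1). -/
def pattern132 : Equiv.Perm (Fin 3) := Equiv.swap 1 2

/-- The pattern (3,2,1) ∈ S₃ (0-indexed: 2,1,0). -/
def pattern321 : Equiv.Perm (Fin 3) := Equiv.swap 0 2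

/-- The pattern (2,3,1) ∈ S₃ (0-indexed: 1,2,0). -/
def pattern231 : Equiv.Perm (Fin 3) := (Equiv.swap 1 2).trans (Equiv.swap 0 1)

/-- `P_n(j,k)` with integer arguments: the number of 123-avoiding permutations of
`{1,…,n}` with value `k` in position `j` (1-indexed); `0` when `j` or `k` is out of
range. -/
noncomputable def PcountZ (n : ℕ) (j k : ℤ) : ℕ :=
  Nat.card {σ : Equiv.Perm (Fin n) //
    Avoids σ pattern123 ∧ ∃ i : Fin n, ((i : ℕ) : ℤ) + 1 = j ∧ ((σ i : ℕ) : ℤ) + 1 = k}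


def Av : ℕ → List ℕ → Prop
  | _, [] => True
  | m, x :: t => (x < m ∧ Av x t) ∨ (¬ x < m ∧ (∀ y ∈ t, ¬ x < y) ∧ Av m t)

def LL (R : Finset ℕ) : Finset (List ℕ) := ⟨R.val.lists, Multiset.lists_nodup_finset R⟩

open Classical in
noncomputable def cnt (R : Finset ℕ) (p : List ℕ → Prop) : ℕ :=
  ((LL R).filter p).card

theorem mem_lists' (R : Finset ℕ) (L : List ℕ) : L ∈ LL R ↔ L.Nodup ∧ L.toFinset = R := by
  change L ∈ R.val.lists ↔ _
  rw [Multiset.mem_lists_iff]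
  constructor
  · intro h
    have h1 : (L : Multiset ℕ).Nodup := by
      have := R.nodup; rw [h] at this; exact this
    refine ⟨by simpa using h1, ?_⟩
    ext x
    rw [List.mem_toFinset, ← Finset.mem_val, h]; simp
  · rintro ⟨h, rfl⟩
    simp [List.toFinset_val, h.dedup]

theorem cnt_congr {R : Finset ℕ} {p p' : List ℕ → Prop}
    (h : ∀ L : List ℕ, L.Nodup → L.toFinset = R → (p L ↔ p' L)) : cnt R p = cnt R p' := by
  classical
  unfold cnt
  congr 1
  apply Finset.filter_congr
  intro L hL
  rw [mem_lists'] at hL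
  exact h L hL.1 hL.2

theorem cnt_zero {R : Finset ℕ} {p : List ℕ → Prop}
    (h : ∀ L : List ℕ, L.Nodup → L.toFinset = R → ¬ p L) : cnt R p = 0 := by
  classical
  unfold cnt
  rw [Finset.card_eq_zero, Finset.filter_eq_empty_iff]
  intro L hL
  rw [mem_lists'] at hL
  exact h L hL.1 hL.2

theorem cnt_rec {R : Finset ℕ} (hR : R.Nonempty) (p : List ℕ → Prop) :
    cnt R p = ∑ x ∈ R, cnt (R.erase x) (fun t => p (x :: t)) := by
  classical
  have : (LL R).filter p =
      R.biUnion (fun x => (((LL (R.erase x)).filter (fun t => p (x :: t))).image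
        (List.cons x))) := by
    ext L
    simp only [Finset.mem_filter, mem_lists', Finset.mem_biUnion, Finset.mem_image]
    constructor
    · rintro ⟨⟨h1, h2⟩, h3⟩
      cases L with
      | nil => simp at h2; rw [← h2] at hR; simp at hR
      | cons x t =>
        rw [List.nodup_cons] at h1
        refine ⟨x, by rw [← h2]; simp, t, ⟨⟨h1.2, ?_⟩, h3⟩, rfl⟩
        rw [← h2, List.toFinset_cons, Finset.erase_insert]
        simpa using h1.1
    · rintro ⟨x, hx, t, ⟨⟨h1, h2⟩, h3⟩, rfl⟩
      refine ⟨⟨?_, ?_⟩, h3⟩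
      · rw [List.nodup_cons]
        refine ⟨?_, h1⟩
        rw [← List.mem_toFinset, h2]; simp
      · rw [List.toFinset_cons, h2, Finset.insert_erase hx]
  unfold cnt
  rw [this, Finset.card_biUnion]
  · apply Finset.sum_congr rfl
    intro x _
    rw [Finset.card_image_of_injective]
    exact List.cons_injective
  · intro x _ y _ hxy
    change Disjoint _ _
    rw [Finset.disjoint_left]
    intro L hL hL'
    simp only [Finset.mem_image] at hL hL'
    obtain ⟨t, _, rfl⟩ := hL
    obtain ⟨t', _, h⟩ := hL'
    simp at h
    exact hxy h.1.symm

/-- rank sum -/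
theorem rank_sum (S : Finset ℕ) (f : ℕ → ℤ) :
    ∑ x ∈ S, f ((S.filter (· < x)).card) = ∑ i ∈ Finset.range S.card, f i := by
  induction S using Finset.induction_on_max with
  | empty => simp
  | insert a S ha ih =>
    have hn : a ∉ S := fun h => lt_irrefl _ (ha a h)
    rw [Finset.sum_insert hn, Finset.card_insert_of_notMem hn, Finset.sum_range_succ, ← ih, add_comm]
    congr 1
    · apply Finset.sum_congr rfl
      intro x hx
      congr 2
      rw [Finset.filter_insert, if_neg]
      exact not_lt.2 (ha x hx).le
    · congr 2
      rw [Finset.filter_insert, if_neg (lt_irrefl _)]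
      exact Finset.filter_true_of_mem ha

def phi (M l j : ℕ) : ℤ := (l + j).choose j - (l + j).choose (M + 1)

theorem phi_sum (M j l : ℕ) (hj : j ≤ M + 1) :
    ∑ i ∈ Finset.range (l + 1), phi M i j = phi (M + 1) l (j + 1) := by
  induction l with
  | zero =>
    simp only [phi, zero_add, Finset.range_one, Finset.sum_singleton, Nat.choose_self]
    rcases Nat.lt_or_ge j (M + 1) with h | h
    · rw [Nat.choose_eq_zero_of_lt h, Nat.choose_eq_zero_of_lt (show j + 1 < M + 1 + 1 by omega)]
    · obtain rfl : j = M + 1 := by omega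
      simp
  | succ l ih =>
    rw [Finset.sum_range_succ, ih]
    simp only [phi]
    have e1 := Nat.choose_succ_succ (l + j + 1) j
    have e2 := Nat.choose_succ_succ (l + j + 1) (M + 1)
    simp only [Nat.succ_eq_add_one] at e1 e2
    rw [show l + 1 + (j + 1) = l + j + 1 + 1 by ring, show l + (j + 1) = l + j + 1 by ring,
      show l + 1 + j = l + j + 1 by ring, e1, e2]
    push_cast; ring

theorem phi_top (M j : ℕ) : phi (M + 1) (M + 1) (j + 1) = phi (M + 1) M (j + 1) := by
  simp only [phi]
  have e1 := Nat.choose_succ_succ (M + j + 1) j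
  have e2 := Nat.choose_succ_succ (M + j + 1) (M + 1)
  have e3 : (M + j + 1).choose j = (M + j + 1).choose (M + 1) :=
    Nat.choose_symm_of_eq_add (by ring)
  simp only [Nat.succ_eq_add_one] at e1 e2
  rw [show M + 1 + (j + 1) = M + j + 1 + 1 by ring, show M + (j + 1) = M + j + 1 by ring, e1, e2, e3]
  push_cast; ring

theorem sum_step (R : Finset ℕ) (m M : ℕ) (hR : R.card = M + 1) (hm : m ∉ R)
    (T f : ℕ → ℤ)
    (h1 : ∀ x ∈ R, x < m → T x = f (R.filter (· < x)).card)
    (h2 : ∀ x ∈ R, m < x → (∀ y ∈ R, y ≤ x) → T x = f (R.filter (· < m)).card)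
    (h3 : ∀ x ∈ R, m < x → (∃ y ∈ R, x < y) → T x = 0) :
    ∑ x ∈ R, T x = ∑ i ∈ Finset.range (min (R.filter (· < m)).card M + 1), f i := by
  classical
  rw [← Finset.sum_filter_add_sum_filter_not R (· < m)]
  have e1 : ∑ x ∈ R.filter (· < m), T x = ∑ i ∈ Finset.range (R.filter (· < m)).card, f i := by
    rw [← rank_sum]
    apply Finset.sum_congr rfl
    intro x hx
    rw [Finset.mem_filter] at hx
    rw [h1 x hx.1 hx.2, Finset.filter_filter]
    congr 2
    apply Finset.filter_congr
    intro y _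
    constructor
    · intro h; exact ⟨h.trans hx.2, h⟩
    · exact fun h => h.2
  rw [e1]
  have hle : (R.filter (· < m)).card ≤ M + 1 := hR ▸ Finset.card_filter_le _ _
  have hne : R.Nonempty := Finset.card_pos.1 (by omega)
  by_cases hmax : R.max' hne < m
  · have : R.filter (· < m) = R :=
      Finset.filter_true_of_mem (fun x hx => (Finset.le_max' R x hx).trans_lt hmax)
    have h2 : R.filter (fun x => ¬ x < m) = ∅ := by
      rw [Finset.filter_eq_empty_iff]
      intro x hx
      simpa using (Finset.le_max' R x hx).trans_lt hmax
    rw [h2, this, hR]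
    simp
  · have hmm := Finset.max'_mem R hne
    have hlt : m < R.max' hne := by
      rcases Nat.lt_or_ge m (R.max' hne) with h | h
      · exact h
      · exact absurd (by rw [le_antisymm (not_lt.1 hmax) h]; exact hmm) hm
    have hlt' : (R.filter (· < m)).card < M + 1 := by
      rw [← hR]
      apply Finset.card_lt_card
      rw [Finset.filter_ssubset]
      exact ⟨_, hmm, hmax⟩
    rw [min_eq_left (by omega), Finset.sum_range_succ]
    congr 1
    rw [Finset.sum_eq_single (R.max' hne)]
    · exact h2 _ hmm hlt (fun y hy => Finset.le_max' R y hy)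
    · intro x hx hx'
      rw [Finset.mem_filter] at hx
      have : x ≠ m := fun h => hm (h ▸ hx.1)
      exact h3 x hx.1 (by omega) ⟨_, hmm, lt_of_le_of_ne (Finset.le_max' R x hx.1) hx'⟩
    · intro h
      exact absurd (Finset.mem_filter.2 ⟨hmm, hmax⟩) h

theorem phi_sum' (M j l : ℕ) (hj : j ≤ M + 1) (hl : l ≤ M + 1) :
    ∑ i ∈ Finset.range (min l M + 1), phi M i j = phi (M + 1) l (j + 1) := by
  rw [phi_sum _ _ _ hj]
  rcases Nat.lt_or_ge M l with h | h
  · obtain rfl : l = M + 1 := by omega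
    rw [phi_top, min_eq_right (by omega)]
  · rw [min_eq_left h]

theorem erase_filter_lt (R : Finset ℕ) (x y : ℕ) (h : y ≤ x) :
    (R.erase x).filter (· < y) = R.filter (· < y) := by
  ext z; simp only [Finset.mem_filter, Finset.mem_erase]; constructor
  · rintro ⟨⟨_, h1⟩, h2⟩; exact ⟨h1, h2⟩
  · rintro ⟨h1, h2⟩; exact ⟨⟨by omega, h1⟩, h2⟩

theorem av_lt {m x : ℕ} {t : List ℕ} (h : x < m) : Av m (x :: t) ↔ Av x t := by
  simp [Av, h]

theorem av_gt {m x : ℕ} {t : List ℕ} (h : m < x) :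
    Av m (x :: t) ↔ (∀ y ∈ t, ¬ x < y) ∧ Av m t := by
  have : ¬ x < m := by omega
  simp only [Av, this, false_and, false_or, not_false_eq_true, true_and]

theorem av_gt_max {R : Finset ℕ} {m x : ℕ} {t : List ℕ} (h : m < x) (hx : ∀ y ∈ R, y ≤ x)
    (ht : t.toFinset = R.erase x) : Av m (x :: t) ↔ Av m t := by
  rw [av_gt h]
  refine and_iff_right ?_
  intro y hy
  rw [← List.mem_toFinset, ht, Finset.mem_erase] at hy
  exact not_lt.2 (hx y hy.2)

theorem av_gt_not {R : Finset ℕ} {m x : ℕ} {t : List ℕ} (h : m < x) (hx : ∃ y ∈ R, x < y)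
    (ht : t.toFinset = R.erase x) : ¬ Av m (x :: t) := by
  rw [av_gt h]
  rintro ⟨h1, _⟩
  obtain ⟨y, hy, hxy⟩ := hx
  refine h1 y ?_ hxy
  rw [← List.mem_toFinset, ht, Finset.mem_erase]
  exact ⟨by omega, hy⟩

theorem cntA (N : ℕ) : ∀ (R : Finset ℕ) (m : ℕ), R.card = N → m ∉ R →
    (cnt R (Av m) : ℤ) = phi N (R.filter (· < m)).card N := by
  induction N with
  | zero =>
    intro R m hR _
    rw [Finset.card_eq_zero] at hR
    subst hR
    have : (LL ∅) = {[]} := by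
      ext L
      rw [mem_lists']
      simp only [List.toFinset_eq_empty_iff, Finset.mem_singleton]
      constructor
      · exact fun h => h.2
      · rintro rfl; simp
    simp [cnt, this, Finset.filter_singleton, Av, phi]
  | succ N ih =>
    intro R m hR hm
    rw [cnt_rec (Finset.card_pos.1 (by omega))]
    push_cast
    have hle : (R.filter (· < m)).card ≤ N + 1 := hR ▸ Finset.card_filter_le _ _
    rw [sum_step R m N hR hm _ (fun i => phi N i N), phi_sum' _ _ _ (by omega) hle]
    · intro x hx hxm
      rw [cnt_congr (p' := Av x) (fun L _ _ => av_lt hxm), ih _ _ (by simp [hx, hR]) (by simp),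
        erase_filter_lt _ _ _ le_rfl]
    · intro x hx hxm hmax
      rw [cnt_congr (p' := Av m) (fun L _ hL => av_gt_max hxm hmax hL),
        ih _ _ (by simp [hx, hR]) (by simp [hm]), erase_filter_lt _ _ _ hxm.le]
    · intro x hx hxm hmax
      rw [cnt_zero (fun L _ hL => av_gt_not hxm hmax hL)]
      rfl

theorem av_after (k : ℕ) (L : List ℕ) : ∀ (m j : ℕ), m < k → Av m L → L[j]? = some k →
    (L.filter (k < ·)).length ≤ j := by
  induction L with
  | nil => intro m j _ _ h; simp at h
  | cons x t ih =>
    intro m j hm hA hj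
    cases j with
    | zero =>
      simp at hj
      subst hj
      rw [av_gt hm] at hA
      simp
      intro y hy
      exact not_lt.1 (hA.1 y hy)
    | succ j =>
      simp at hj
      have : (t.filter (k < ·)).length ≤ j := by
        rcases hA with ⟨h1, h2⟩ | ⟨_, _, h2⟩
        · exact ih x j (by omega) h2 hj
        · exact ih m j hm h2 hj
      rw [List.filter_cons]
      split
      · simpa using this
      · omega

theorem cntH (k : ℕ) : ∀ (j A M : ℕ) (R : Finset ℕ) (m : ℕ), k ∈ R → k < m → m ∉ R →
    R.card = A + 1 + j → (R.filter (k < ·)).card = M → j < M →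
    (cnt R (fun L => Av m L ∧ L[j]? = some k) : ℤ) =
      phi A (R.filter (· < k)).card A * phi M ((R.filter (k < ·)).filter (· < m)).card j := by
  intro j
  induction j with
  | zero =>
    intro A M R m hk hkm hm hR hM hjM
    have hc : ((R.filter (k < ·)).filter (· < m)).card ≤ M := hM ▸ Finset.card_filter_le _ _
    rw [cnt_rec ⟨k, hk⟩]
    push_cast
    rw [Finset.sum_eq_single k]
    · rw [cnt_congr (p' := Av k) (fun L _ _ => by simp [av_lt hkm]), cntA A _ _ (by simp [hk, hR])
        (by simp), erase_filter_lt _ _ _ le_rfl]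
      have : phi M ((R.filter (k < ·)).filter (· < m)).card 0 = 1 := by
        simp only [phi, add_zero, Nat.choose_zero_right]
        rw [Nat.choose_eq_zero_of_lt (by omega)]; simp
      rw [this, mul_one]
    · intro x _ hx
      rw [cnt_zero (fun L _ _ => by simp [hx])]; rfl
    · exact fun h => absurd hk h
  | succ j ih =>
    intro A M R m hk hkm hm hR hM hjM
    have hc : ((R.filter (k < ·)).filter (· < m)).card ≤ M := hM ▸ Finset.card_filter_le _ _
    rw [cnt_rec ⟨k, hk⟩]
    push_cast
    obtain ⟨M, rfl⟩ : ∃ M', M = M' + 1 := ⟨M - 1, by omega⟩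
    have hsub : ∑ x ∈ R.filter (k < ·),
        (cnt (R.erase x) (fun t => Av m (x :: t) ∧ (x :: t)[j + 1]? = some k) : ℤ) =
        ∑ x ∈ R, (cnt (R.erase x) (fun t => Av m (x :: t) ∧ (x :: t)[j + 1]? = some k) : ℤ) := by
      apply Finset.sum_subset (Finset.filter_subset _ _)
      intro x hx hx'
      have hxk : x ≤ k := by
        by_contra h
        exact hx' (Finset.mem_filter.2 ⟨hx, not_le.1 h⟩)
      rw [cnt_zero]; rfl
      rintro L hLn hL ⟨hA, hj⟩
      simp only [List.getElem?_cons_succ] at hj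
      have hkL : k ∈ L := List.mem_of_getElem? hj
      rw [← List.mem_toFinset, hL, Finset.mem_erase] at hkL
      have hlt : x < k := by omega
      rw [av_lt (by omega)] at hA
      have h1 := av_after k L x j hlt hA hj
      have h2 : (L.filter (k < ·)).toFinset = R.filter (k < ·) := by
        ext y
        simp only [List.mem_toFinset, List.mem_filter, Finset.mem_filter, decide_eq_true_eq]
        rw [← List.mem_toFinset, hL, Finset.mem_erase]
        constructor
        · rintro ⟨⟨_, h1⟩, h2⟩; exact ⟨h1, h2⟩
        · rintro ⟨h1, h2⟩; exact ⟨⟨by omega, h1⟩, h2⟩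
      rw [← List.toFinset_card_of_nodup (hLn.filter _), h2, hM] at h1
      omega
    rw [← hsub]
    have hm' : m ∉ R.filter (k < ·) := fun h => hm (Finset.mem_of_mem_filter _ h)
    have hq : ∀ x, k < x → (R.erase x).filter (· < k) = R.filter (· < k) :=
      fun x hx => erase_filter_lt _ _ _ hx.le
    have hcomm : ∀ x, (R.erase x).filter (k < ·) = (R.filter (k < ·)).erase x :=
      fun x => Finset.filter_erase _ _ _
    rw [sum_step (R.filter (k < ·)) m M hM hm' _
      (fun i => phi A (R.filter (· < k)).card A * phi M i j), ← Finset.mul_sum,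
      phi_sum' _ _ _ (by omega) hc]
    · intro x hx hxm
      have hx' := hx
      rw [Finset.mem_filter] at hx
      rw [cnt_congr (p' := fun L => Av x L ∧ L[j]? = some k)
        (fun L _ _ => by simp [av_lt hxm]),
        ih A M _ _ (by simp [hk]; omega) hx.2 (by simp) (by simp [hx.1, hR])
          (by rw [hcomm, Finset.card_erase_of_mem hx', hM]; rfl) (by omega), hq _ hx.2, hcomm,
        erase_filter_lt _ _ _ le_rfl]
    · intro x hx hxm hmax
      have hx' := hx
      rw [Finset.mem_filter] at hx
      have hmax' : ∀ y ∈ R, y ≤ x := by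
        intro y hy
        rcases Nat.lt_or_ge k y with h | h
        · exact hmax y (Finset.mem_filter.2 ⟨hy, h⟩)
        · omega
      rw [cnt_congr (p' := fun L => Av m L ∧ L[j]? = some k)
        (fun L _ hL => by simp [av_gt_max hxm hmax' hL]),
        ih A M _ _ (by simp [hk]; omega) hkm (by simp [hm]) (by simp [hx.1, hR])
          (by rw [hcomm, Finset.card_erase_of_mem hx', hM]; rfl) (by omega), hq _ hx.2, hcomm,
        erase_filter_lt _ _ _ hxm.le]
    · intro x hx hxm ⟨y, hy, hxy⟩
      rw [cnt_zero (fun L _ hL h =>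
        av_gt_not hxm ⟨y, Finset.mem_of_mem_filter _ hy, hxy⟩ hL h.1)]
      rfl

theorem av_iff (L : List ℕ) : ∀ m : ℕ, m ∉ L → L.Nodup →
    (Av m L ↔ ∀ a b c : ℕ, List.Sublist [a, b, c] (m :: L) → a < b → ¬ b < c) := by
  induction L with
  | nil =>
    intro m _ _
    simp only [Av, true_iff]
    intro a b c h
    have := h.length_le
    simp at this
  | cons x t ih =>
    intro m hm hL
    rw [List.nodup_cons] at hL
    simp only [List.mem_cons, not_or] at hm
    rcases Nat.lt_or_ge x m with hxm | hxm
    · rw [av_lt hxm, ih x hL.1 hL.2]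
      constructor
      · intro h a b c hs hab hbc
        rcases List.sublist_cons_iff.1 hs with hs' | ⟨r, hr, hs'⟩
        · exact h a b c hs' hab hbc
        · simp only [List.cons.injEq] at hr
          obtain ⟨rfl, rfl⟩ := hr
          rcases List.sublist_cons_iff.1 hs' with hs'' | ⟨r, hr, hs''⟩
          · exact h x b c (hs''.cons_cons x) (by omega) hbc
          · simp only [List.cons.injEq] at hr
            omega
      · intro h a b c hs hab hbc
        exact h a b c (hs.cons m) hab hbc
    · have hxm : m < x := by omega
      rw [av_gt hxm, ih m hm.2 hL.2]
      constructor
      · rintro ⟨h1, h2⟩ a b c hs hab hbc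
        rcases List.sublist_cons_iff.1 hs with hs' | ⟨r, hr, hs'⟩
        · rcases List.sublist_cons_iff.1 hs' with hs'' | ⟨r, hr, hs''⟩
          · exact h2 a b c (hs''.cons m) hab hbc
          · simp only [List.cons.injEq] at hr
            obtain ⟨rfl, rfl⟩ := hr
            exact h1 b (hs''.subset (by simp)) hab
        · simp only [List.cons.injEq] at hr
          obtain ⟨rfl, rfl⟩ := hr
          rcases List.sublist_cons_iff.1 hs' with hs'' | ⟨r, hr, hs''⟩
          · exact h2 a b c (hs''.cons_cons a) hab hbc
          · simp only [List.cons.injEq] at hr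
            obtain ⟨rfl, rfl⟩ := hr
            exact h1 c (hs''.subset (by simp)) hbc
      · intro h
        refine ⟨fun y hy hxy => ?_, fun a b c hs hab hbc => ?_⟩
        · exact h m x y (((List.singleton_sublist.2 hy).cons_cons x).cons_cons m) hxm hxy
        · refine h a b c ?_ hab hbc
          exact hs.trans ((List.sublist_cons_self x t).cons_cons m)

theorem av_top_iff (L : List ℕ) (n : ℕ) (hn : ∀ x ∈ L, x < n) (hL : L.Nodup) :
    (Av n L ↔ ∀ a b c : ℕ, List.Sublist [a, b, c] L → a < b → ¬ b < c) := by
  rw [av_iff L n (fun h => lt_irrefl _ (hn n h)) hL]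
  constructor
  · intro h a b c hs
    exact h a b c (hs.cons n)
  · intro h a b c hs hab hbc
    rcases List.sublist_cons_iff.1 hs with hs' | ⟨r, hr, hs'⟩
    · exact h a b c hs' hab hbc
    · simp only [List.cons.injEq] at hr
      obtain ⟨rfl, rfl⟩ := hr
      have := hn b (hs'.subset (by simp))
      omega

theorem avoids_iff {n : ℕ} (σ : Equiv.Perm (Fin n)) :
    Avoids σ pattern123 ↔ ∀ i j k : Fin n, i < j → j < k → σ i < σ j → ¬ σ j < σ k := by
  unfold Avoids ContainsPattern
  constructor
  · intro h i j k hij hjk h1 h2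
    apply h
    refine ⟨![i, j, k], ?_, ?_⟩
    · rw [Fin.strictMono_iff_lt_succ]
      intro a
      fin_cases a
      · simpa using hij
      · simpa using hjk
    · intro a b
      fin_cases a <;> fin_cases b <;> simp [pattern123, h1, h2, h1.le, h2.le, h1.trans h2, (h1.trans h2).le]
  · rintro h ⟨f, hf, hp⟩
    refine h (f 0) (f 1) (f 2) (hf (by decide)) (hf (by decide)) ?_ ?_
    · rw [hp]; decide
    · rw [hp]; decide

theorem avoids_iff_av {n : ℕ} (σ : Equiv.Perm (Fin n)) :
    Avoids σ pattern123 ↔ Av n (List.ofFn (fun i => (σ i : ℕ))) := by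
  rw [av_top_iff, avoids_iff]
  · constructor
    · intro h a b c hs hab hbc
      rw [List.sublist_iff_exists_fin_orderEmbedding_get_eq] at hs
      obtain ⟨f, hf⟩ := hs
      have h0 := hf ⟨0, by simp⟩
      have h1 := hf ⟨1, by simp⟩
      have h2 := hf ⟨2, by simp⟩
      have l01 : f ⟨0, by simp⟩ < f ⟨1, by simp⟩ := f.strictMono (by simp)
      have l12 : f ⟨1, by simp⟩ < f ⟨2, by simp⟩ := f.strictMono (by simp)
      simp only [List.get_eq_getElem, List.getElem_ofFn] at h0 h1 h2
      simp only [List.getElem_cons_zero, List.getElem_cons_succ] at h0 h1 h2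
      have hb : ∀ i, (f i : ℕ) < n := fun i => (f i).2.trans_eq List.length_ofFn
      refine h ⟨_, hb _⟩ ⟨_, hb _⟩ ⟨_, hb _⟩ (Fin.mk_lt_mk.2 (Fin.lt_def.1 l01)) (Fin.mk_lt_mk.2 (Fin.lt_def.1 l12)) ?_ ?_
      · rw [Fin.lt_def, ← h0, ← h1]; exact hab
      · rw [Fin.lt_def, ← h1, ← h2]; exact hbc
    · intro h i j k hij hjk h1 h2
      refine h (σ i) (σ j) (σ k) ?_ h1 h2
      rw [List.sublist_iff_exists_fin_orderEmbedding_get_eq]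
      have hmono : StrictMono (fun a : Fin 3 => Fin.cast (List.length_ofFn (f := fun i => (σ i : ℕ))).symm
          ((![i, j, k] : Fin 3 → Fin n) a)) := by
        rw [Fin.strictMono_iff_lt_succ]
        intro a
        fin_cases a
        · simpa using hij
        · simpa using hjk
      refine ⟨OrderEmbedding.ofStrictMono _ hmono, ?_⟩
      intro a
      change Fin 3 at a
      fin_cases a <;> simp [OrderEmbedding.ofStrictMono]
  · simp [List.mem_ofFn]
  · rw [List.nodup_ofFn]
    intro i j h
    exact σ.injective (Fin.ext h)

theorem PcountZ_eq (n j q : ℕ) (hj : j < n) (hq : q < n) :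
    PcountZ n (j + 1 : ℤ) (q + 1 : ℤ) =
      cnt (Finset.range n) (fun L => Av n L ∧ L[j]? = some q) := by
  classical
  unfold PcountZ cnt
  rw [Nat.card_eq_fintype_card, Fintype.card_subtype]
  refine Finset.card_bij (fun σ _ => List.ofFn (fun i => (σ i : ℕ))) ?_ ?_ ?_
  · intro σ hσ
    simp only [Finset.mem_filter, Finset.mem_univ, true_and] at hσ
    obtain ⟨h1, i, h2, h3⟩ := hσ
    simp only [Finset.mem_filter, mem_lists']
    refine ⟨⟨?_, ?_⟩, (avoids_iff_av σ).1 h1, ?_⟩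
    · rw [List.nodup_ofFn]
      intro i j h
      exact σ.injective (Fin.ext h)
    · ext x
      simp only [List.mem_toFinset, List.mem_ofFn, Finset.mem_range]
      constructor
      · rintro ⟨i, rfl⟩; exact (σ i).2
      · intro hx
        exact ⟨σ.symm ⟨x, hx⟩, by simp⟩
    · rw [List.getElem?_ofFn, dif_pos hj]
      have : i = ⟨j, hj⟩ := Fin.ext (by simp; omega)
      rw [← this]
      congr 1
      omega
  · intro σ _ τ _ h
    have := List.ofFn_injective h
    ext i
    exact congrFun this i
  · intro L hL
    simp only [Finset.mem_filter, mem_lists'] at hL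
    obtain ⟨⟨h1, h2⟩, h3, h4⟩ := hL
    have hlen : L.length = n := by
      rw [← List.toFinset_card_of_nodup h1, h2, Finset.card_range]
    have hlt : ∀ x ∈ L, x < n := by
      intro x hx
      rw [← List.mem_toFinset, h2] at hx
      simpa using hx
    subst hlen
    let f : Fin L.length → Fin L.length := fun i => ⟨L.get i, hlt _ (List.get_mem _ _)⟩
    have hf : Function.Injective f := by
      intro i j h
      have := congrArg Fin.val h
      exact (List.nodup_iff_injective_get.1 h1) this
    let σ : Equiv.Perm (Fin L.length) := Equiv.ofBijective f (Finite.injective_iff_bijective.1 hf)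
    have hσ : List.ofFn (fun i => (σ i : ℕ)) = L := by
      change List.ofFn (fun i => L.get i) = L
      exact List.ofFn_get L
    refine ⟨σ, ?_, hσ⟩
    simp only [Finset.mem_filter, Finset.mem_univ, true_and]
    refine ⟨?_, ⟨j, hj⟩, by simp, ?_⟩
    · rw [avoids_iff_av, hσ]; exact h3
    · have : ((σ ⟨j, hj⟩ : Fin _) : ℕ) = q := by
        change L.get ⟨j, hj⟩ = q
        rw [List.getElem?_eq_some_iff] at h4
        obtain ⟨_, h4⟩ := h4
        simpa using h4
      rw [this]

theorem PcountZ_symm (n : ℕ) (j k : ℤ) :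
    PcountZ n j k = PcountZ n (n + 1 - j) (n + 1 - k) := by
  unfold PcountZ
  refine Nat.card_congr (Equiv.subtypeEquiv (Equiv.mulLeft Fin.revPerm |>.trans (Equiv.mulRight Fin.revPerm)) ?_)
  intro σ
  have hval : ∀ i, ((Equiv.mulLeft Fin.revPerm).trans (Equiv.mulRight Fin.revPerm)) σ i
      = Fin.rev (σ (Fin.rev i)) := fun i => by simp
  constructor
  · rintro ⟨h1, i, h2, h3⟩
    refine ⟨?_, Fin.rev i, ?_, ?_⟩
    · rw [avoids_iff] at h1 ⊢
      intro a b c hab hbc h4 h5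
      rw [hval, hval, Fin.rev_lt_rev] at h4 h5
      exact h1 _ _ _ (Fin.rev_lt_rev.2 hbc) (Fin.rev_lt_rev.2 hab) h5 h4
    · rw [Fin.val_rev]; omega
    · rw [hval, Fin.rev_rev, Fin.val_rev]; omega
  · rintro ⟨h1, i, h2, h3⟩
    rw [hval, Fin.val_rev] at h3
    refine ⟨?_, Fin.rev i, ?_, ?_⟩
    · rw [avoids_iff] at h1 ⊢
      intro a b c hab hbc h4 h5
      refine h1 _ _ _ (Fin.rev_lt_rev.2 hbc) (Fin.rev_lt_rev.2 hab) ?_ ?_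
      · rw [hval, hval, Fin.rev_lt_rev, Fin.rev_rev, Fin.rev_rev]; exact h5
      · rw [hval, hval, Fin.rev_lt_rev, Fin.rev_rev, Fin.rev_rev]; exact h4
    · rw [Fin.val_rev]; omega
    · omega

theorem PcountZ_phi (n j q : ℕ) (h : j + q + 1 < n) :
    (PcountZ n (j + 1 : ℤ) (q + 1 : ℤ) : ℤ) =
      phi (n - 1 - j) q (n - 1 - j) * phi (n - 1 - q) (n - 1 - q) j := by
  have e1 : (Finset.range n).filter (· < q) = Finset.range q := by
    ext x; simp; omega
  have e2 : (Finset.range n).filter (q < ·) = Finset.Ioo q n := by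
    ext x; simp; omega
  have e3 : (Finset.Ioo q n).filter (· < n) = Finset.Ioo q n := by
    ext x; simp
  rw [PcountZ_eq n j q (by omega) (by omega),
    cntH q j (n - 1 - j) (n - 1 - q) (Finset.range n) n (by simp; omega) (by omega) (by simp)
      (by simp; omega) (by rw [e2, Nat.card_Ioo]; omega) (by omega), e1, e2, e3, Nat.card_Ioo,
      Finset.card_range]
  rw [show n - q - 1 = n - 1 - q by omega]

theorem phi_closed (M l : ℕ) : ((phi M l M : ℤ) : ℝ) * (M + 1) = ((M : ℝ) + 1 - l) * ((l + M).choose l : ℝ) := by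
  have h := Nat.choose_succ_right_eq (l + M) M
  rw [Nat.add_sub_cancel] at h
  have h2 : (l + M).choose M = (l + M).choose l := Nat.choose_symm_of_eq_add (by ring)
  have h' : ((l + M).choose (M + 1) : ℝ) * (M + 1) = (l + M).choose M * l := by exact_mod_cast h
  simp only [phi]
  push_cast
  rw [sub_mul, h', h2]; ring

theorem phi_closed' (M j : ℕ) : ((phi M M j : ℤ) : ℝ) * (M + 1) = ((M : ℝ) + 1 - j) * ((j + M).choose j : ℝ) := by
  have h := Nat.choose_succ_right_eq (M + j) M
  rw [Nat.add_sub_cancel_left] at h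
  have h2 : (M + j).choose M = (M + j).choose j := Nat.choose_symm_of_eq_add (by ring)
  have h' : ((M + j).choose (M + 1) : ℝ) * (M + 1) = (M + j).choose M * j := by exact_mod_cast h
  simp only [phi]
  push_cast
  rw [sub_mul, h', h2, add_comm j M]; ring

theorem PcountZ_closed (n j q : ℕ) (h : j + q + 1 < n) :
    (PcountZ n (j + 1 : ℤ) (q + 1 : ℤ) : ℝ) =
      ((n : ℝ) - j - q) ^ 2 / (((n : ℝ) - j) * ((n : ℝ) - q)) *
        ((q + (n - 1 - j)).choose q : ℝ) * ((j + (n - 1 - q)).choose j : ℝ) := by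
  have h0 := congrArg (Int.cast : ℤ → ℝ) (PcountZ_phi n j q h)
  have h1 := phi_closed (n - 1 - j) q
  have h2 := phi_closed' (n - 1 - q) j
  have c1 : ((n - 1 - j : ℕ) : ℝ) = (n : ℝ) - 1 - j := by
    rw [Nat.cast_sub (by omega), Nat.cast_sub (by omega)]; simp
  have c2 : ((n - 1 - q : ℕ) : ℝ) = (n : ℝ) - 1 - q := by
    rw [Nat.cast_sub (by omega), Nat.cast_sub (by omega)]; simp
  rw [c1] at h1
  rw [c2] at h2
  push_cast at h0
  rw [h0]
  have p1 : (0 : ℝ) < n - j := by rw [sub_pos]; exact_mod_cast (by omega)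
  have p2 : (0 : ℝ) < n - q := by rw [sub_pos]; exact_mod_cast (by omega)
  rw [div_mul_eq_mul_div, div_mul_eq_mul_div, eq_div_iff (by positivity)]
  calc _ = ((phi (n - 1 - j) q (n - 1 - j) : ℤ) * ((n : ℝ) - 1 - j + 1)) * ((phi (n - 1 - q) (n - 1 - q) j : ℤ) * ((n : ℝ) - 1 - q + 1)) := by ring
    _ = _ := by rw [h1, h2]; ring

theorem choose_asymp (u v : ℕ → ℕ) (hu : Tendsto u atTop atTop) (hv : Tendsto v atTop atTop)
    (h : Tendsto (fun n => ((u n : ℝ) - v n) ^ 2 / ((u n : ℝ) + v n)) atTop (nhds 0)) :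
    Tendsto (fun n => ((u n + v n).choose (u n) : ℝ) * √((u n : ℝ) + v n) / 2 ^ (u n + v n))
      atTop (nhds (√2 / √π)) := by
  have hN : Tendsto (fun n => u n + v n) atTop atTop :=
    tendsto_atTop_mono (fun n => Nat.le_add_right _ _) hu
  have s1 := Stirling.tendsto_stirlingSeq_sqrt_pi.comp hu
  have s2 := Stirling.tendsto_stirlingSeq_sqrt_pi.comp hv
  have s3 := Stirling.tendsto_stirlingSeq_sqrt_pi.comp hN
  have eu : ∀ᶠ n in atTop, 0 < u n := hu.eventually_gt_atTop 0
  have ev : ∀ᶠ n in atTop, 0 < v n := hv.eventually_gt_atTop 0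
  -- the exponential factor
  have hX : Tendsto (fun n => (u n : ℝ) * Real.log (2 * u n / ((u n : ℝ) + v n)) +
      v n * Real.log (2 * v n / ((u n : ℝ) + v n))) atTop (nhds 0) := by
    refine tendsto_of_tendsto_of_tendsto_of_le_of_le' tendsto_const_nhds h ?_ ?_
    · filter_upwards [eu, ev] with n hu hv
      have hu' : (0 : ℝ) < u n := by exact_mod_cast hu
      have hv' : (0 : ℝ) < v n := by exact_mod_cast hv
      have l1 := Real.one_sub_inv_le_log_of_pos (show (0 : ℝ) < 2 * u n / ((u n : ℝ) + v n) by positivity)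
      have l2 := Real.one_sub_inv_le_log_of_pos (show (0 : ℝ) < 2 * v n / ((u n : ℝ) + v n) by positivity)
      have m1 := mul_le_mul_of_nonneg_left l1 hu'.le
      have m2 := mul_le_mul_of_nonneg_left l2 hv'.le
      have : (u n : ℝ) * (1 - (2 * u n / ((u n : ℝ) + v n))⁻¹) +
        v n * (1 - (2 * v n / ((u n : ℝ) + v n))⁻¹) = 0 := by field_simp; ring
      linarith
    · filter_upwards [eu, ev] with n hu hv
      have hu' : (0 : ℝ) < u n := by exact_mod_cast hu
      have hv' : (0 : ℝ) < v n := by exact_mod_cast hv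
      have l1 := Real.log_le_sub_one_of_pos (show (0 : ℝ) < 2 * u n / ((u n : ℝ) + v n) by positivity)
      have l2 := Real.log_le_sub_one_of_pos (show (0 : ℝ) < 2 * v n / ((u n : ℝ) + v n) by positivity)
      have m1 := mul_le_mul_of_nonneg_left l1 hu'.le
      have m2 := mul_le_mul_of_nonneg_left l2 hv'.le
      have : (u n : ℝ) * (2 * u n / ((u n : ℝ) + v n) - 1) +
        v n * (2 * v n / ((u n : ℝ) + v n) - 1) = ((u n : ℝ) - v n) ^ 2 / ((u n : ℝ) + v n) := by
        field_simp; ring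
      linarith
  have hE : Tendsto (fun n => ((2 * u n / ((u n : ℝ) + v n)) ^ (u n) *
      (2 * v n / ((u n : ℝ) + v n)) ^ (v n))⁻¹) atTop (nhds 1) := by
    have := (Real.continuous_exp.tendsto 0).comp hX
    rw [Real.exp_zero] at this
    have := this.inv₀ one_ne_zero
    rw [inv_one] at this
    refine this.congr' ?_
    filter_upwards [eu, ev] with n hu hv
    have hu' : (0 : ℝ) < u n := by exact_mod_cast hu
    have hv' : (0 : ℝ) < v n := by exact_mod_cast hv
    simp only [Function.comp]
    rw [Real.exp_add, Real.exp_nat_mul, Real.exp_nat_mul, Real.exp_log (by positivity),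
      Real.exp_log (by positivity)]
  -- the square root factor
  have hNr : Tendsto (fun n => (u n : ℝ) + v n) atTop atTop := by
    have := (tendsto_natCast_atTop_atTop (R := ℝ)).comp hN
    refine this.congr (fun n => by simp)
  have hR : Tendsto (fun n => √((1 - ((u n : ℝ) - v n) ^ 2 / ((u n : ℝ) + v n) * ((u n : ℝ) + v n)⁻¹) / 4))
      atTop (nhds (1 / 2)) := by
    have := ((h.mul hNr.inv_tendsto_atTop).const_sub 1).div_const 4
    have := this.sqrt
    simp only [mul_zero, sub_zero] at this
    rw [show √(1 / 4 : ℝ) = 1 / 2 by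
      rw [show (1 / 4 : ℝ) = (1 / 2) ^ 2 by norm_num]; exact Real.sqrt_sq (by norm_num)] at this
    exact this
  have hπ : (0 : ℝ) < √π := Real.sqrt_pos.2 Real.pi_pos
  have key := ((s3.div (s1.mul s2) (by positivity)).mul
    (hR.inv₀ (by norm_num))).mul hE |>.mul_const (1 / √2)
  have e : √π / (√π * √π) * (1 / 2)⁻¹ * 1 * (1 / √2) = √2 / √π := by
    have h2 : (√2) ^ 2 = 2 := Real.sq_sqrt (by norm_num)
    field_simp
    rw [h2]
  rw [e] at key
  refine key.congr' ?_
  filter_upwards [eu, ev] with n hu hv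
  have hu' : (0 : ℝ) < u n := by exact_mod_cast hu
  have hv' : (0 : ℝ) < v n := by exact_mod_cast hv
  simp only [Function.comp, Pi.div_apply, Stirling.stirlingSeq]
  have hch : ((u n + v n).choose (u n) : ℝ) =
      ((u n + v n).factorial : ℝ) / ((u n).factorial * (v n).factorial) := by
    rw [Nat.choose_symm_add, Nat.add_choose, Nat.cast_div (Nat.factorial_mul_factorial_dvd_factorial_add _ _)
      (by positivity)]
    push_cast; rfl
  rw [hch]
  generalize ((u n + v n).factorial : ℝ) = F
  have f1 : ((u n).factorial : ℝ) ≠ 0 := by positivity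
  have f2 : ((v n).factorial : ℝ) ≠ 0 := by positivity
  generalize ((u n).factorial : ℝ) = F1 at *
  generalize ((v n).factorial : ℝ) = F2 at *
  push_cast
  generalize (u n : ℝ) = x at *
  generalize (v n : ℝ) = y at *
  have r1 : √((1 - (x - y) ^ 2 / (x + y) * (x + y)⁻¹) / 4) = √x * √y / (x + y) := by
    rw [show (1 - (x - y) ^ 2 / (x + y) * (x + y)⁻¹) / 4 = x * y / (x + y) ^ 2 by field_simp; ring,
      Real.sqrt_div (by positivity), Real.sqrt_sq (by positivity), Real.sqrt_mul hu'.le]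
  rw [r1, Real.sqrt_mul (by norm_num), Real.sqrt_mul (by norm_num), Real.sqrt_mul (by norm_num)]
  simp only [div_pow, mul_pow, pow_add]
  have q : √(x + y) ^ 2 = x + y := Real.sq_sqrt (by positivity)
  have q1 : √x ^ 2 = x := Real.sq_sqrt (by positivity)
  have q2 : √y ^ 2 = y := Real.sq_sqrt (by positivity)
  have q3 : √(2 : ℝ) ^ 2 = 2 := Real.sq_sqrt (by norm_num)
  have p : 0 < √(x + y) := Real.sqrt_pos.2 (by positivity)
  have p1 : 0 < √x := Real.sqrt_pos.2 (by positivity)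
  have p2 : 0 < √y := Real.sqrt_pos.2 (by positivity)
  field_simp
  simp only [q]

theorem main_nat (a : ℝ) (ha0 : 0 < a) (ha1 : a < 1) (d α : ℝ) (hα1 : α < 1 / 2)
    (j q : ℕ → ℕ) (h : ∀ᶠ n in atTop, j n + q n + 1 < n)
    (hj : Tendsto (fun n : ℕ => (j n : ℝ) / n) atTop (nhds a))
    (hq : Tendsto (fun n : ℕ => (q n : ℝ) / n) atTop (nhds (1 - a)))
    (hd : Tendsto (fun n : ℕ => ((n : ℝ) - j n - q n) / (n : ℝ) ^ α) atTop (nhds (2 * d))) :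
    Tendsto (fun n : ℕ => (n : ℝ) ^ ((3 : ℝ) / 2 - 2 * α) *
        (PcountZ n (j n + 1 : ℤ) (q n + 1 : ℤ) : ℝ) / (catalan n : ℝ)) atTop
      (nhds (d ^ 2 / (√π * (a * (1 - a)) ^ ((3 : ℝ) / 2)))) := by
  have hcast : Tendsto (fun n : ℕ => (n : ℝ)) atTop atTop := tendsto_natCast_atTop_atTop
  have hinv : Tendsto (fun n : ℕ => 1 / (n : ℝ)) atTop (nhds 0) := tendsto_one_div_atTop_nhds_zero_nat
  have ha1' : 0 < 1 - a := by linarith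
  have hpos : ∀ᶠ n : ℕ in atTop, 0 < n := eventually_gt_atTop 0
  -- casts
  have cj : ∀ᶠ n : ℕ in atTop, ((n - 1 - j n : ℕ) : ℝ) = (n : ℝ) - 1 - j n := by
    filter_upwards [h] with n hn
    rw [Nat.cast_sub (by omega), Nat.cast_sub (by omega)]; simp
  have cq : ∀ᶠ n : ℕ in atTop, ((n - 1 - q n : ℕ) : ℝ) = (n : ℝ) - 1 - q n := by
    filter_upwards [h] with n hn
    rw [Nat.cast_sub (by omega), Nat.cast_sub (by omega)]; simp
  -- ratio limits
  have rj : Tendsto (fun n : ℕ => ((n : ℝ) - j n) / n) atTop (nhds (1 - a)) := by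
    refine (hj.const_sub 1).congr' ?_
    filter_upwards [hpos] with n hn
    have : (0 : ℝ) < n := by exact_mod_cast hn
    field_simp
  have rq : Tendsto (fun n : ℕ => ((n : ℝ) - q n) / n) atTop (nhds a) := by
    have := hq.const_sub 1
    rw [sub_sub_cancel] at this
    refine this.congr' ?_
    filter_upwards [hpos] with n hn
    have : (0 : ℝ) < n := by exact_mod_cast hn
    field_simp
  have rj1 : Tendsto (fun n : ℕ => ((n - 1 - j n : ℕ) : ℝ) / n) atTop (nhds (1 - a)) := by
    have := rj.sub hinv
    rw [sub_zero] at this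
    refine this.congr' ?_
    filter_upwards [cj] with n hn
    rw [hn]; ring
  have rq1 : Tendsto (fun n : ℕ => ((n - 1 - q n : ℕ) : ℝ) / n) atTop (nhds a) := by
    have := rq.sub hinv
    rw [sub_zero] at this
    refine this.congr' ?_
    filter_upwards [cq] with n hn
    rw [hn]; ring
  have rN1 : Tendsto (fun n : ℕ => ((q n : ℝ) + ((n - 1 - j n : ℕ) : ℝ)) / n) atTop
      (nhds (2 * (1 - a))) := by
    have := hq.add rj1
    rw [← two_mul] at this
    exact this.congr (fun n => by ring)
  have rN2 : Tendsto (fun n : ℕ => ((j n : ℝ) + ((n - 1 - q n : ℕ) : ℝ)) / n) atTop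
      (nhds (2 * a)) := by
    have := hj.add rq1
    rw [← two_mul] at this
    exact this.congr (fun n => by ring)
  have toTop : ∀ (f : ℕ → ℕ) (b : ℝ), 0 < b →
      Tendsto (fun n : ℕ => (f n : ℝ) / n) atTop (nhds b) → Tendsto f atTop atTop := by
    intro f b hb hf
    have h1 := hf.pos_mul_atTop hb hcast
    rw [← tendsto_natCast_atTop_iff (R := ℝ)]
    refine h1.congr' ?_
    filter_upwards [hpos] with n hn
    have : (0 : ℝ) < n := by exact_mod_cast hn
    field_simp
  -- deviation
  have dev : Tendsto (fun n : ℕ => ((n : ℝ) - j n - q n - 1) ^ 2 / n) atTop (nhds 0) := by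
    have p1 : Tendsto (fun n : ℕ => (n : ℝ) ^ (-(1 / 2 - α))) atTop (nhds 0) :=
      (tendsto_rpow_neg_atTop (by linarith)).comp hcast
    have p2 : Tendsto (fun n : ℕ => (n : ℝ) ^ (-(1 / 2 : ℝ))) atTop (nhds 0) :=
      (tendsto_rpow_neg_atTop (by norm_num)).comp hcast
    have := ((hd.mul p1).sub p2).pow 2
    rw [mul_zero, sub_zero, zero_pow (by norm_num)] at this
    refine this.congr' ?_
    filter_upwards [hpos] with n hn
    have hn' : (0 : ℝ) < n := by exact_mod_cast hn
    have e1 : (n : ℝ) ^ (-(1 / 2 - α)) = (n : ℝ) ^ α * (n : ℝ) ^ (-(1 / 2 : ℝ)) := by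
      rw [← Real.rpow_add hn']; congr 1; ring
    have e2 : ((n : ℝ) ^ (-(1 / 2 : ℝ))) ^ 2 = (n : ℝ)⁻¹ := by
      rw [← Real.rpow_natCast, ← Real.rpow_mul hn'.le, ← Real.rpow_neg_one]; norm_num
    have e3 : (n : ℝ) ^ α ≠ 0 := (Real.rpow_pos_of_pos hn' _).ne'
    generalize (n : ℝ) ^ (-(1 / 2 : ℝ)) = B at *
    rw [e1, div_eq_mul_inv _ (n : ℝ), ← e2]
    field_simp
  have X1 := choose_asymp q (fun n => n - 1 - j n) (toTop _ _ ha1' hq) (toTop _ _ ha1' rj1) (by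
    have := dev.div rN1 (by positivity)
    rw [zero_div] at this
    refine this.congr' ?_
    filter_upwards [hpos, cj] with n hn hc
    have hn' : (0 : ℝ) < n := by exact_mod_cast hn
    simp only [Pi.div_apply]
    rw [div_div_div_cancel_right₀ hn'.ne']
    congr 1
    rw [hc]; ring)
  have X2 := choose_asymp j (fun n => n - 1 - q n) (toTop _ _ ha0 hj) (toTop _ _ ha0 rq1) (by
    have := dev.div rN2 (by positivity)
    rw [zero_div] at this
    refine this.congr' ?_
    filter_upwards [hpos, cq] with n hn hc
    have hn' : (0 : ℝ) < n := by exact_mod_cast hn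
    simp only [Pi.div_apply]
    rw [div_div_div_cancel_right₀ hn'.ne']
    congr 1
    rw [hc]; ring)
  have X0 := choose_asymp (fun n => n) (fun n => n) tendsto_id tendsto_id (by simp)
  have hn1 : Tendsto (fun n : ℕ => ((n : ℝ) + 1) / n) atTop (nhds 1) := by
    have := hinv.const_add 1
    rw [add_zero] at this
    refine this.congr' ?_
    filter_upwards [hpos] with n hn
    have hn' : (0 : ℝ) < n := by exact_mod_cast hn
    field_simp
  have hπ : (0 : ℝ) < √π := Real.sqrt_pos.2 Real.pi_pos
  have h2 : (0 : ℝ) < √2 := by positivity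
  have key := (((((hd.pow 2).mul ((X1.mul X2).div X0 (by positivity))).mul
    ((rj.inv₀ ha1'.ne').mul (rq.inv₀ ha0.ne'))).mul
    ((rN1.sqrt.inv₀ (by positivity)).mul (rN2.sqrt.inv₀ (by positivity)))).mul hn1).mul_const (√2 / 4)
  have e : (2 * d) ^ 2 * (√2 / √π * (√2 / √π) / (√2 / √π)) * ((1 - a)⁻¹ * a⁻¹) *
      ((√(2 * (1 - a)))⁻¹ * (√(2 * a))⁻¹) * 1 * (√2 / 4) =
      d ^ 2 / (√π * (a * (1 - a)) ^ ((3 : ℝ) / 2)) := by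
    have e1 : (a * (1 - a)) ^ ((3 : ℝ) / 2) = (a * (1 - a)) * (√a * √(1 - a)) := by
      rw [show (3 : ℝ) / 2 = 1 + 1 / 2 by norm_num, Real.rpow_add (by positivity), Real.rpow_one,
        ← Real.sqrt_eq_rpow, Real.sqrt_mul ha0.le]
    rw [e1, Real.sqrt_mul (by norm_num), Real.sqrt_mul (by norm_num)]
    have p1 : 0 < √a := Real.sqrt_pos.2 ha0
    have p2 : 0 < √(1 - a) := Real.sqrt_pos.2 ha1'
    field_simp
    norm_num
    ring
  rw [e] at key
  refine key.congr' ?_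
  have tN1 := rN1.eventually_const_lt (show (0 : ℝ) < 2 * (1 - a) by positivity)
  have tN2 := rN2.eventually_const_lt (show (0 : ℝ) < 2 * a by positivity)
  filter_upwards [hpos, cj, cq, h, tN1, tN2] with n hn hcj hcq hlt g1 g2
  have hn' : (0 : ℝ) < n := by exact_mod_cast hn
  rw [PcountZ_closed n (j n) (q n) hlt]
  have hcat : (catalan n : ℝ) = ((n + n).choose n : ℝ) / (n + 1) := by
    rw [catalan_eq_centralBinom_div, Nat.cast_div (Nat.succ_dvd_centralBinom n) (by positivity),
      Nat.centralBinom_eq_two_mul_choose, two_mul]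
    push_cast; rfl
  have hpw : (n : ℝ) ^ ((3 : ℝ) / 2 - 2 * α) = n * √n / ((n : ℝ) ^ α) ^ 2 := by
    rw [Real.rpow_sub hn', show (3 : ℝ) / 2 = 1 + 1 / 2 by norm_num, Real.rpow_add hn',
      Real.rpow_one, ← Real.sqrt_eq_rpow, mul_comm 2 α, Real.rpow_mul hn'.le]
    norm_num
  have hpow : (2 : ℝ) ^ (q n + (n - 1 - j n)) * 2 ^ (j n + (n - 1 - q n)) * 4 = 2 ^ (n + n) := by
    rw [show (4 : ℝ) = 2 ^ 2 by norm_num, ← pow_add, ← pow_add]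
    congr 1; omega
  have hA : 0 < (n : ℝ) ^ α := Real.rpow_pos_of_pos hn' _
  have p1 : (0 : ℝ) < n - j n := by rw [sub_pos]; exact_mod_cast (by omega)
  have p2 : (0 : ℝ) < n - q n := by rw [sub_pos]; exact_mod_cast (by omega)
  rw [hcat, hpw]
  simp only [Pi.div_apply]
  have g1' : 0 < (q n : ℝ) + ((n - 1 - j n : ℕ) : ℝ) := by
    rwa [lt_div_iff₀ hn', zero_mul] at g1
  have g2' : 0 < (j n : ℝ) + ((n - 1 - q n : ℕ) : ℝ) := by
    rwa [lt_div_iff₀ hn', zero_mul] at g2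
  have hC : (0 : ℝ) < ((n + n).choose n : ℝ) := by
    exact_mod_cast Nat.choose_pos (by omega)
  rw [← two_mul (n : ℝ), Real.sqrt_mul (by norm_num) (n : ℝ), Real.sqrt_div g1'.le, Real.sqrt_div g2'.le,
    ← hpow]
  have s1 := Real.sqrt_pos.2 g1'
  have s2 := Real.sqrt_pos.2 g2'
  have s0 := Real.sqrt_pos.2 hn'
  have sn : √(n : ℝ) ^ 2 = n := Real.sq_sqrt hn'.le
  generalize √((q n : ℝ) + ((n - 1 - j n : ℕ) : ℝ)) = S1 at *
  generalize √((j n : ℝ) + ((n - 1 - q n : ℕ) : ℝ)) = S2 at *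
  generalize ((n + n).choose n : ℝ) = C0 at *
  generalize ((q n + (n - 1 - j n)).choose (q n) : ℝ) = C1 at *
  generalize ((j n + (n - 1 - q n)).choose (j n) : ℝ) = C2 at *
  generalize (n : ℝ) ^ α = A at *
  field_simp

theorem main_int (a : ℝ) (ha0 : 0 < a) (ha1 : a < 1) (d α : ℝ) (hd0 : 0 < d) (hα0 : 0 < α)
    (hα1 : α < 1 / 2) (J K : ℕ → ℤ)
    (hJ : Tendsto (fun n : ℕ => (J n : ℝ) / n) atTop (nhds a))
    (hK : Tendsto (fun n : ℕ => (K n : ℝ) / n) atTop (nhds (1 - a)))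
    (hd : Tendsto (fun n : ℕ => ((n : ℝ) - J n - K n) / (n : ℝ) ^ α) atTop (nhds (2 * d))) :
    Tendsto (fun n : ℕ => (n : ℝ) ^ ((3 : ℝ) / 2 - 2 * α) *
        (PcountZ n (J n) (K n) : ℝ) / (catalan n : ℝ)) atTop
      (nhds (d ^ 2 / (√π * (a * (1 - a)) ^ ((3 : ℝ) / 2)))) := by
  have hcast : Tendsto (fun n : ℕ => (n : ℝ)) atTop atTop := tendsto_natCast_atTop_atTop
  have hinv : Tendsto (fun n : ℕ => 1 / (n : ℝ)) atTop (nhds 0) := tendsto_one_div_atTop_nhds_zero_nat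
  have ha1' : 0 < 1 - a := by linarith
  have hpos : ∀ᶠ n : ℕ in atTop, 0 < n := eventually_gt_atTop 0
  have hJ1 : ∀ᶠ n in atTop, 1 ≤ J n := by
    filter_upwards [hJ.eventually_const_lt ha0, hpos] with n h1 hn
    have hn' : (0 : ℝ) < n := by exact_mod_cast hn
    rw [lt_div_iff₀ hn', zero_mul] at h1
    have : 0 < J n := by exact_mod_cast h1
    omega
  have hK1 : ∀ᶠ n in atTop, 1 ≤ K n := by
    filter_upwards [hK.eventually_const_lt ha1', hpos] with n h1 hn
    have hn' : (0 : ℝ) < n := by exact_mod_cast hn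
    rw [lt_div_iff₀ hn', zero_mul] at h1
    have : 0 < K n := by exact_mod_cast h1
    omega
  have hs : ∀ᶠ n : ℕ in atTop, J n + K n < n := by
    filter_upwards [hd.eventually_const_lt (show (0 : ℝ) < 2 * d by positivity), hpos] with n h1 hn
    have hn' : (0 : ℝ) < n := by exact_mod_cast hn
    rw [lt_div_iff₀ (Real.rpow_pos_of_pos hn' _), zero_mul] at h1
    have : (J n : ℝ) + K n < n := by linarith
    exact_mod_cast this
  have cJ : ∀ᶠ n in atTop, (((J n - 1).toNat : ℕ) : ℤ) = J n - 1 := by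
    filter_upwards [hJ1] with n hn
    omega
  have cK : ∀ᶠ n in atTop, (((K n - 1).toNat : ℕ) : ℤ) = K n - 1 := by
    filter_upwards [hK1] with n hn
    omega
  have cJ' : ∀ᶠ n in atTop, (((J n - 1).toNat : ℕ) : ℝ) = (J n : ℝ) - 1 := by
    filter_upwards [cJ] with n hn
    exact_mod_cast congrArg (Int.cast : ℤ → ℝ) hn
  have cK' : ∀ᶠ n in atTop, (((K n - 1).toNat : ℕ) : ℝ) = (K n : ℝ) - 1 := by
    filter_upwards [cK] with n hn
    exact_mod_cast congrArg (Int.cast : ℤ → ℝ) hn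
  have hnα : Tendsto (fun n : ℕ => 2 * (n : ℝ) ^ (-α)) atTop (nhds 0) := by
    have := ((tendsto_rpow_neg_atTop hα0).comp hcast).const_mul 2
    rw [mul_zero] at this
    exact this
  have := main_nat a ha0 ha1 d α hα1 (fun n => (J n - 1).toNat) (fun n => (K n - 1).toNat) ?_ ?_ ?_ ?_
  · refine this.congr' ?_
    filter_upwards [cJ, cK] with n h1 h2
    rw [h1, h2, sub_add_cancel, sub_add_cancel]
  · filter_upwards [cJ, cK, hs] with n h1 h2 h3
    omega
  · have := hJ.sub hinv
    rw [sub_zero] at this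
    refine this.congr' ?_
    filter_upwards [cJ'] with n h1
    rw [h1]; ring
  · have := hK.sub hinv
    rw [sub_zero] at this
    refine this.congr' ?_
    filter_upwards [cK'] with n h1
    rw [h1]; ring
  · have := hd.add hnα
    rw [add_zero] at this
    refine this.congr' ?_
    filter_upwards [cJ', cK', hpos] with n h1 h2 hn
    have hn' : (0 : ℝ) < n := by exact_mod_cast hn
    rw [h1, h2, Real.rpow_neg hn'.le]; ring

/-- For `0 < α < 1/2` and `c ≠ 0`,
`n^{3/2-2α} P_n(⌊an - c n^α⌋, ⌊(1-a)n - c n^α⌋)/C_n → c²/(√π (a(1-a))^{3/2})`. -/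
theorem Pcount_near_antidiagonal_limit (a : ℝ) (ha0 : 0 < a) (ha1 : a < 1)
    (c : ℝ) (hc : c ≠ 0) (α : ℝ) (hα0 : 0 < α) (hα1 : α < 1 / 2) :
    Tendsto (fun n : ℕ =>
        (n : ℝ) ^ ((3 : ℝ) / 2 - 2 * α) *
          (PcountZ n ⌊a * n - c * (n : ℝ) ^ α⌋ ⌊(1 - a) * n - c * (n : ℝ) ^ α⌋ : ℝ) /
          (catalan n : ℝ))
      atTop
      (nhds (c ^ 2 / (Real.sqrt π * (a * (1 - a)) ^ ((3 : ℝ) / 2)))) := by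
  have hcast : Tendsto (fun n : ℕ => (n : ℝ)) atTop atTop := tendsto_natCast_atTop_atTop
  have hinv : Tendsto (fun n : ℕ => 1 / (n : ℝ)) atTop (nhds 0) := tendsto_one_div_atTop_nhds_zero_nat
  have ha1' : 0 < 1 - a := by linarith
  have hpos : ∀ᶠ n : ℕ in atTop, 0 < n := eventually_gt_atTop 0
  have hnα : Tendsto (fun n : ℕ => 2 * (n : ℝ) ^ (-α)) atTop (nhds 0) := by
    have := ((tendsto_rpow_neg_atTop hα0).comp hcast).const_mul 2
    rw [mul_zero] at this
    exact this
  have hnα1 : Tendsto (fun n : ℕ => c * (n : ℝ) ^ (-(1 - α))) atTop (nhds 0) := by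
    have := ((tendsto_rpow_neg_atTop (show 0 < 1 - α by linarith)).comp hcast).const_mul c
    rw [mul_zero] at this
    exact this
  have hgen : ∀ b : ℝ, Tendsto (fun n : ℕ => (⌊b * n - c * (n : ℝ) ^ α⌋ : ℝ) / n) atTop (nhds b) := by
    intro b
    have hup := hnα1.const_sub b
    have hlo := hup.sub hinv
    rw [sub_zero] at hup
    rw [sub_zero, sub_zero] at hlo
    have hexp : ∀ n : ℕ, 0 < n →
        b - c * (n : ℝ) ^ (-(1 - α)) = (b * n - c * (n : ℝ) ^ α) / n := by
      intro n hn
      have hn' : (0 : ℝ) < n := by exact_mod_cast hn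
      rw [show -(1 - α) = α - 1 by ring, Real.rpow_sub hn', Real.rpow_one]
      field_simp
    refine tendsto_of_tendsto_of_tendsto_of_le_of_le' hlo hup ?_ ?_
    · filter_upwards [hpos] with n hn
      have hn' : (0 : ℝ) < n := by exact_mod_cast hn
      rw [hexp n hn, ← sub_div]
      exact div_le_div_of_nonneg_right (Int.sub_one_lt_floor _).le hn'.le
    · filter_upwards [hpos] with n hn
      have hn' : (0 : ℝ) < n := by exact_mod_cast hn
      rw [hexp n hn]
      exact div_le_div_of_nonneg_right (Int.floor_le _) hn'.le
  have hJ := hgen a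
  have hK := hgen (1 - a)
  have hD : Tendsto (fun n : ℕ => ((n : ℝ) - ⌊a * n - c * (n : ℝ) ^ α⌋ -
      ⌊(1 - a) * n - c * (n : ℝ) ^ α⌋) / (n : ℝ) ^ α) atTop (nhds (2 * c)) := by
    have hup := hnα.const_add (2 * c)
    rw [add_zero] at hup
    refine tendsto_of_tendsto_of_tendsto_of_le_of_le' tendsto_const_nhds hup ?_ ?_
    · filter_upwards [hpos] with n hn
      have hn' : (0 : ℝ) < n := by exact_mod_cast hn
      rw [le_div_iff₀ (Real.rpow_pos_of_pos hn' _)]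
      have h1 := Int.floor_le (a * n - c * (n : ℝ) ^ α)
      have h2 := Int.floor_le ((1 - a) * n - c * (n : ℝ) ^ α)
      linarith
    · filter_upwards [hpos] with n hn
      have hn' : (0 : ℝ) < n := by exact_mod_cast hn
      have hA := Real.rpow_pos_of_pos hn' α
      rw [div_le_iff₀ hA, Real.rpow_neg hn'.le, add_mul, mul_assoc 2 (((n : ℝ) ^ α)⁻¹),
        inv_mul_cancel₀ hA.ne']
      have h1 := (Int.sub_one_lt_floor (a * n - c * (n : ℝ) ^ α)).le
      have h2 := (Int.sub_one_lt_floor ((1 - a) * n - c * (n : ℝ) ^ α)).le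
      linarith
  rcases lt_or_gt_of_ne hc with hneg | hc0
  · have := main_int (1 - a) ha1' (by linarith) (-c) α (by linarith) hα0 hα1
      (fun n => (n : ℤ) + 1 - ⌊a * n - c * (n : ℝ) ^ α⌋)
      (fun n => (n : ℤ) + 1 - ⌊(1 - a) * n - c * (n : ℝ) ^ α⌋) ?_ ?_ ?_
    · rw [neg_sq, sub_sub_cancel, mul_comm (1 - a) a] at this
      refine this.congr (fun n => ?_)
      rw [← PcountZ_symm]
    · have := (hinv.const_add 1).sub hJ
      rw [add_zero] at this
      refine this.congr' ?_
      filter_upwards [hpos] with n hn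
      have hn' : (0 : ℝ) < n := by exact_mod_cast hn
      push_cast
      field_simp
    · have := (hinv.const_add 1).sub hK
      rw [add_zero] at this
      refine this.congr' ?_
      filter_upwards [hpos] with n hn
      have hn' : (0 : ℝ) < n := by exact_mod_cast hn
      push_cast
      field_simp
    · have := hD.neg.sub hnα
      rw [sub_zero, ← mul_neg] at this
      refine this.congr' ?_
      filter_upwards [hpos] with n hn
      have hn' : (0 : ℝ) < n := by exact_mod_cast hn
      rw [Real.rpow_neg hn'.le]
      push_cast
      ring
  · exact main_int a ha0 ha1 c α hc0 hα0 hα1 _ _ hJ hK hD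
end

section
/- Let a ∈ (0,1) and c ∈ ℝ with c ≠ 0. Then lim_{n→∞} n^{1/2} · P_n(⌊an − c·√n⌋, ⌊(1−a)n − c·√n⌋) / C_n = (c² / (√π · (a(1−a))^{3/2})) · exp(−c² / (a(1−a))). -/
open Filter Finset Real

namespace PC

def Q (N r : ℕ) (σ : Equiv.Perm (Fin N)) : Prop :=
  ∀ i j : Fin N, i < j → σ i < σ j → (σ i : ℕ) < r ∧ ∀ h : Fin N, h < i → σ i < σ h

lemma consFun_inj {N : ℕ} (v : Fin (N+1)) (τ : Equiv.Perm (Fin N)) :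
    Function.Injective (Fin.cons v (fun i => v.succAbove (τ i)) : Fin (N+1) → Fin (N+1)) := by
  rw [Fin.cons_injective_iff]
  refine ⟨?_, ?_⟩
  · rintro ⟨i, hi⟩
    exact Fin.succAbove_ne _ _ hi
  · exact Fin.succAbove_right_injective.comp τ.injective

noncomputable def consP {N : ℕ} (v : Fin (N+1)) (τ : Equiv.Perm (Fin N)) :
    Equiv.Perm (Fin (N+1)) :=
  Equiv.ofBijective _ (Finite.injective_iff_bijective.mp (consFun_inj v τ))

@[simp] lemma consP_zero {N : ℕ} (v : Fin (N+1)) (τ : Equiv.Perm (Fin N)) :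
    consP v τ 0 = v := rfl

@[simp] lemma consP_succ {N : ℕ} (v : Fin (N+1)) (τ : Equiv.Perm (Fin N)) (i : Fin N) :
    consP v τ i.succ = v.succAbove (τ i) := rfl

lemma consP_bij (N : ℕ) : Function.Bijective
    (fun p : Fin (N+1) × Equiv.Perm (Fin N) => consP p.1 p.2) := by
  rw [Fintype.bijective_iff_injective_and_card]
  refine ⟨?_, ?_⟩
  · rintro ⟨v, τ⟩ ⟨v', τ'⟩ h
    simp only at h
    have h0 : v = v' := by
      have := congrArg (fun f : Equiv.Perm (Fin (N+1)) => f 0) h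
      simpa using this
    subst h0
    have : τ = τ' := by
      ext i : 1
      have := congrArg (fun f : Equiv.Perm (Fin (N+1)) => f i.succ) h
      simpa using this
    rw [this]
  · simp [Fintype.card_perm, Nat.factorial_succ]

lemma sA_val {N : ℕ} (v : Fin (N+1)) (x : Fin N) :
    ((v.succAbove x : Fin (N+1)) : ℕ) = if (x : ℕ) < v then (x : ℕ) else x + 1 := by
  unfold Fin.succAbove
  simp only [Fin.lt_def, Fin.val_castSucc]
  split_ifs <;> simp

lemma Q_cons {N r : ℕ} (v : Fin (N+1)) (τ : Equiv.Perm (Fin N)) :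
    Q (N+1) r (consP v τ) ↔ ((v : ℕ) < r ∧ Q N v τ) ∨ ((v : ℕ) = N ∧ r ≤ N ∧ Q N r τ) := by
  unfold Q
  simp only [Fin.forall_fin_succ, consP_zero, consP_succ, Fin.lt_def, sA_val, Fin.val_zero,
    Fin.val_succ]
  have hN : ∀ i, (τ i : ℕ) < N := fun i => (τ i).2
  have hv := v.2
  constructor
  · rintro ⟨⟨-, h1⟩, h2⟩
    by_cases hvr : (v : ℕ) < r
    · left
      refine ⟨hvr, fun i j hij hlt => ?_⟩
      have := (h2 i).2 j (by omega) (by split_ifs <;> omega)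
      obtain ⟨ha, hb, hc⟩ := this
      have hb := hb (by omega)
      refine ⟨by split_ifs at hb <;> omega, fun h hh => ?_⟩
      have := hc h (by omega)
      split_ifs at this <;> omega
    · right
      have hvN : (v : ℕ) = N := by
        by_contra hne
        have h3 : (v : ℕ) < N := by omega
        have := (h1 (τ.symm ⟨v, h3⟩) (by omega) (by simp)).1
        omega
      refine ⟨hvN, by omega, fun i j hij hlt => ?_⟩
      have := (h2 i).2 j (by omega) (by split_ifs <;> omega)
      obtain ⟨ha, hb, hc⟩ := this
      have := hN i
      refine ⟨by split_ifs at ha <;> omega, fun h hh => ?_⟩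
      have := hc h (by omega)
      split_ifs at this <;> omega
  · rintro (⟨hvr, h⟩ | ⟨hvN, hr, h⟩)
    · refine ⟨⟨by omega, fun j _ _ => ⟨hvr, by omega, by omega⟩⟩, fun i => ⟨by omega, ?_⟩⟩
      intro j hij hlt
      have hlt' : (τ i : ℕ) < τ j := by split_ifs at hlt <;> omega
      obtain ⟨ha, hb⟩ := h i j (by omega) hlt'
      refine ⟨by split_ifs; omega, by intro _; split_ifs; omega, fun l hl => ?_⟩
      have := hb l (by omega)
      split_ifs <;> omega
    · refine ⟨⟨by omega, fun j _ hj => ?_⟩, fun i => ⟨by omega, ?_⟩⟩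
      · have := hN j
        split_ifs at hj <;> omega
      intro j hij hlt
      have hlt' : (τ i : ℕ) < τ j := by split_ifs at hlt <;> omega
      obtain ⟨ha, hb⟩ := h i j (by omega) hlt'
      have := hN i
      refine ⟨by split_ifs <;> omega, by intro _; split_ifs <;> omega, fun l hl => ?_⟩
      have := hb l (by omega)
      split_ifs <;> omega

open Classical in
/-- Number of permutations with `Q` and `P`. -/
noncomputable def cnt (N : ℕ) (P : Equiv.Perm (Fin N) → Prop) : ℕ :=
  (univ.filter P).card

lemma cnt_congr {N : ℕ} {P P' : Equiv.Perm (Fin N) → Prop} (h : ∀ σ, P σ ↔ P' σ) :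
    cnt N P = cnt N P' := by
  have : P = P' := funext fun σ => propext (h σ)
  rw [this]

lemma cnt_zero {N : ℕ} {P : Equiv.Perm (Fin N) → Prop} (h : ∀ σ, ¬ P σ) :
    cnt N P = 0 := by
  classical
  unfold cnt
  simp [h]

lemma cnt_succ {N : ℕ} (P : Equiv.Perm (Fin (N+1)) → Prop) :
    cnt (N+1) P = ∑ v : Fin (N+1), cnt N (fun τ => P (consP v τ)) := by
  classical
  unfold cnt
  simp only [Finset.card_filter]
  rw [← Fintype.sum_prod_type']
  exact (Function.Bijective.sum_comp (consP_bij N) (fun σ => if P σ then 1 else 0)).symm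

noncomputable def H (N r : ℕ) : ℕ := cnt N (Q N r)

lemma H_zero (r : ℕ) : H 0 r = 1 := by
  classical
  unfold H cnt
  rw [Finset.filter_true_of_mem]
  · simp
  · intro σ _ i
    exact i.elim0

lemma sum_aux (N r : ℕ) (f : ℕ → ℕ) (hr : r ≤ N + 1) :
    ∑ v : Fin (N+1), (if (v : ℕ) < r then f v else if (v : ℕ) = N then f r else 0)
      = ∑ v ∈ range (min r N + 1), f v := by
  rw [Fin.sum_univ_eq_sum_range (fun v => if v < r then f v else if v = N then f r else 0) (N+1)]
  rcases Nat.lt_or_ge N r with h | h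
  · have : r = N + 1 := by omega
    subst this
    rw [min_eq_right (by omega)]
    apply Finset.sum_congr rfl
    intro v hv
    simp at hv
    simp [hv]
  · rw [min_eq_left h, Finset.sum_range_succ, Finset.sum_range_succ]
    simp only [if_true]
    rw [if_neg (by omega)]
    congr 1
    obtain ⟨d, rfl⟩ := Nat.exists_eq_add_of_le h
    rw [Finset.sum_range_add]
    have h1 : ∑ x ∈ range d, (if r + x < r then f (r + x) else if r + x = r + d then f r else 0) = 0 := by
      apply Finset.sum_eq_zero
      intro x hx
      simp at hx
      rw [if_neg (by omega), if_neg (by omega)]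
    rw [h1, add_zero]
    apply Finset.sum_congr rfl
    intro v hv
    simp at hv
    simp [hv]

lemma H_succ (N r : ℕ) (hr : r ≤ N + 1) : H (N+1) r = ∑ v ∈ range (min r N + 1), H N v := by
  unfold H
  rw [cnt_succ, ← sum_aux N r (fun v => cnt N (Q N v)) hr]
  apply Finset.sum_congr rfl
  intro v _
  split_ifs with h1 h2
  · apply cnt_congr
    intro τ
    rw [Q_cons]
    constructor
    · rintro (h | h)
      · exact h.2
      · omega
    · intro h; exact Or.inl ⟨h1, h⟩
  · apply cnt_congr
    intro τ
    rw [Q_cons]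
    constructor
    · rintro (h | h)
      · omega
      · exact h.2.2
    · intro h; exact Or.inr ⟨h2, by omega, h⟩
  · apply cnt_zero
    intro τ
    rw [Q_cons]
    omega

/-- Closed form. -/
def w (M s j : ℕ) : ℤ := ((s + j).choose j : ℤ) - ((s + j).choose (M + 1) : ℤ)

lemma w_rec (M s j : ℕ) : w (M+1) (s+1) (j+1) = w (M+1) s (j+1) + w M (s+1) j := by
  unfold w
  have h1 : (s + 1 + (j + 1)).choose (j+1) = (s + (j+1)).choose (j+1) + (s+1+j).choose j := by
    rw [show s + 1 + (j+1) = (s+1+j)+1 by ring, Nat.choose_succ_succ,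
      show s + (j+1) = s + 1 + j by ring]; simp; ring
  have h2 : (s + 1 + (j + 1)).choose (M+1+1) = (s + (j+1)).choose (M+1+1) + (s+1+j).choose (M+1) := by
    rw [show s + 1 + (j+1) = (s+1+j)+1 by ring, Nat.choose_succ_succ,
      show s + (j+1) = s + 1 + j by ring]; simp; ring
  rw [h1, h2]; push_cast; ring

lemma w_zero (M j : ℕ) (h : j ≤ M) : w M 0 j = 1 := by
  unfold w
  simp [Nat.choose_eq_zero_of_lt (show j < M + 1 by omega)]

lemma w_zero_right (M s : ℕ) (h : s ≤ M) : w M s 0 = 1 := by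
  unfold w
  simp [Nat.choose_eq_zero_of_lt (show s < M + 1 by omega)]

lemma w_bdry (M j : ℕ) : w M (M+1) j = 0 := by
  unfold w
  rw [Nat.choose_symm_add]; simp

lemma w_sum (M j t : ℕ) (hj : j ≤ M) :
    ∑ v ∈ range (t + 1), w M v j = w (M+1) t (j+1) := by
  induction t with
  | zero => simp [w_zero M j hj, w_zero (M+1) (j+1) (by omega)]
  | succ t ih => rw [Finset.sum_range_succ, ih, w_rec]

lemma w_sum_min (M j t : ℕ) (hj : j ≤ M) (ht : t ≤ M + 1) :
    ∑ v ∈ range (min t M + 1), w M v j = w (M+1) t (j+1) := by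
  rw [w_sum M j _ hj]
  rcases Nat.lt_or_ge M t with h | h
  · have : t = M + 1 := by omega
    subst this
    rw [w_rec, w_bdry]; simp
  · rw [min_eq_left h]

lemma H_eq (N r : ℕ) (hr : r ≤ N) : (H N r : ℤ) = w N r N := by
  induction N generalizing r with
  | zero =>
    obtain rfl : r = 0 := by omega
    rw [H_zero, w_zero _ _ le_rfl]; rfl
  | succ N ih =>
    rw [H_succ N r hr, ← w_sum_min N N r le_rfl hr]
    push_cast
    apply Finset.sum_congr rfl
    intro v hv
    simp at hv
    exact ih v (by omega)

noncomputable def G (N r j k : ℕ) : ℕ :=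
  cnt N (fun σ => Q N r σ ∧ ∃ i : Fin N, (i : ℕ) = j ∧ (σ i : ℕ) = k)

lemma vanish {N v j k : ℕ} (σ : Equiv.Perm (Fin N)) (hQ : Q N v σ) (hv : v ≤ k)
    (hjk : j + k + 2 ≤ N) (i : Fin N) (hi : (i : ℕ) = j) (hk : (σ i : ℕ) = k) : False := by
  have h1 : ∀ l, i < l → σ l < σ i := by
    intro l hl
    by_contra hcon
    have hne : σ l ≠ σ i := fun h => by
      have := σ.injective h
      omega
    have := (hQ i l hl (lt_of_le_of_ne (not_lt.mp hcon) hne.symm)).1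
    omega
  have h2 : (Finset.Ioi i).card ≤ (Finset.Iio (σ i)).card := by
    apply Finset.card_le_card_of_injOn σ
    · intro l hl
      simp at hl ⊢
      exact h1 l hl
    · exact σ.injective.injOn
  simp at h2
  omega

lemma G_zero (N r k : ℕ) (hk : k < r) (hr : r ≤ N + 1) : G (N+1) r 0 k = H N k := by
  unfold G H
  rw [cnt_succ, Finset.sum_eq_single (⟨k, by omega⟩ : Fin (N+1))]
  · apply cnt_congr
    intro τ
    rw [Q_cons]
    constructor
    · rintro ⟨h | h, -⟩
      · exact h.2
      · simp at h; omega
    · intro h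
      exact ⟨Or.inl ⟨hk, h⟩, 0, by simp, by simp⟩
  · intro v _ hv
    apply cnt_zero
    rintro τ ⟨-, i, hi, h⟩
    have : i = 0 := Fin.ext (by simpa using hi)
    subst this
    simp at h
    exact hv (Fin.ext h)
  · simp

lemma G_succ (N r j k : ℕ) (hk : k < r) (hr : r ≤ N + 1) (hjk : j + k + 1 ≤ N) :
    G (N+1) r (j+1) k = ∑ v ∈ range (min r N + 1), if k < v then G N v j k else 0 := by
  rw [← sum_aux N r (fun v => if k < v then G N v j k else 0) hr]
  unfold G
  rw [cnt_succ]
  have key : ∀ (v : Fin (N+1)) (τ : Equiv.Perm (Fin N)), k < (v : ℕ) →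
      ((∃ i : Fin (N+1), (i : ℕ) = j + 1 ∧ (consP v τ i : ℕ) = k) ↔
        ∃ i : Fin N, (i : ℕ) = j ∧ (τ i : ℕ) = k) := by
    intro v τ hv
    constructor
    · rintro ⟨i, hi, h⟩
      obtain ⟨i', rfl⟩ := Fin.exists_succ_eq.mpr (show i ≠ 0 by
        rintro rfl; simp at hi)
      rw [consP_succ, sA_val] at h
      refine ⟨i', by simpa using hi, ?_⟩
      split_ifs at h <;> omega
    · rintro ⟨i, hi, h⟩
      refine ⟨i.succ, by simpa using hi, ?_⟩
      rw [consP_succ, sA_val, if_pos (by omega), h]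
  apply Finset.sum_congr rfl
  intro v _
  split_ifs with h1 h2 h2
  · apply cnt_congr
    intro τ
    rw [Q_cons, key v τ h2]
    constructor
    · rintro ⟨h | h, h'⟩
      · exact ⟨h.2, h'⟩
      · omega
    · rintro ⟨h, h'⟩; exact ⟨Or.inl ⟨h1, h⟩, h'⟩
  · apply cnt_zero
    rintro τ ⟨hQ, i, hi, h⟩
    rw [Q_cons] at hQ
    rcases hQ with hQ | hQ
    swap; · omega
    obtain ⟨i', rfl⟩ := Fin.exists_succ_eq.mpr (show i ≠ 0 by
        rintro rfl; simp at hi)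
    rw [consP_succ, sA_val] at h
    simp at hi
    have h3 : (τ i' : ℕ) + 1 = k ∧ (v : ℕ) ≤ τ i' := by split_ifs at h <;> omega
    exact vanish τ hQ.2 h3.2 (by omega) i' hi rfl
  · apply cnt_congr
    intro τ
    rw [Q_cons, key v τ (by omega)]
    constructor
    · rintro ⟨h | h, h'⟩
      · omega
      · exact ⟨h.2.2, h'⟩
    · rintro ⟨h, h'⟩; exact ⟨Or.inr ⟨h2, by omega, h⟩, h'⟩
  · apply cnt_zero
    intro τ
    rw [Q_cons]
    omega

lemma G_eq (N r j k : ℕ) (hk : k < r) (hr : r ≤ N) (hjk : j + k + 1 ≤ N) :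
    (G N r j k : ℤ) = w (N - 1 - j) k (N - 1 - j) * w (N - 1 - k) (r - 1 - k) j := by
  induction j generalizing N r with
  | zero =>
    obtain ⟨N, rfl⟩ : ∃ N', N = N' + 1 := ⟨N - 1, by omega⟩
    rw [G_zero N r k hk hr, H_eq N k (by omega), w_zero_right _ _ (by omega)]
    simp
  | succ j ih =>
    obtain ⟨N, rfl⟩ : ∃ N', N = N' + 1 := ⟨N - 1, by omega⟩
    rw [G_succ N r j k hk hr (by omega)]
    obtain ⟨s, rfl⟩ : ∃ s, r = k + 1 + s := ⟨r - (k+1), by omega⟩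
    obtain ⟨M, rfl⟩ : ∃ M, N = k + 1 + M := ⟨N - (k+1), by omega⟩
    rw [show k + 1 + M + 1 - 1 - k = M + 1 by omega, show k + 1 + s - 1 - k = s by omega,
      ← w_sum_min M j s (by omega) (by omega), show min (k+1+s) (k+1+M) + 1 = (k + 1) + (min s M + 1) by omega,
      Finset.sum_range_add, Finset.sum_eq_zero (s := range (k+1)), zero_add, Finset.mul_sum]
    · push_cast
      apply Finset.sum_congr rfl
      intro v hv
      simp at hv
      rw [if_pos (by omega), ih _ _ (by omega) (by omega) (by omega)]
      congr 2 <;> omega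
    · intro v hv
      simp at hv
      rw [if_neg (by omega)]

lemma avoids_iff {n : ℕ} (σ : Equiv.Perm (Fin n)) : Avoids σ pattern123 ↔ Q n n σ := by
  unfold Avoids ContainsPattern Q pattern123
  constructor
  · intro h i j hij hlt
    refine ⟨(σ i).2, fun l hl => ?_⟩
    by_contra hcon
    have hne : σ l ≠ σ i := fun h => by
      have := σ.injective h
      omega
    have h1 : σ l < σ i := lt_of_le_of_ne (not_lt.mp hcon) hne
    apply h
    refine ⟨![l, i, j], ?_, ?_⟩
    · intro a b hab
      fin_cases a <;> fin_cases b <;> simp at hab ⊢ <;> order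
    · intro a b
      fin_cases a <;> fin_cases b <;> simp <;> order
  · rintro h ⟨f, hf, hf'⟩
    have h01 := (hf' 0 1).mpr (by simp)
    have h12 := (hf' 1 2).mpr (by simp)
    have := (h (f 1) (f 2) (hf (by simp)) h12).2 (f 0) (hf (by simp))
    order

lemma PcountZ_eq (n j k : ℕ) (h : j + k + 1 ≤ n) :
    (PcountZ n (j+1) (k+1) : ℤ) = w (n - 1 - j) k (n - 1 - j) * w (n - 1 - k) (n - 1 - k) j := by
  rw [← G_eq n n j k (by omega) le_rfl h]
  classical
  unfold PcountZ G cnt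
  rw [Nat.card_eq_fintype_card, Fintype.card_subtype]
  congr 2
  ext σ
  simp only [Finset.mem_filter, avoids_iff]
  refine and_congr Iff.rfl (and_congr Iff.rfl (exists_congr fun i => ?_))
  omega

lemma Q_rev {n : ℕ} (σ : Equiv.Perm (Fin n)) (h : Avoids σ pattern123) :
    Avoids (Fin.revPerm.trans (σ.trans Fin.revPerm)) pattern123 := by
  rintro ⟨f, hf, hf'⟩
  apply h
  refine ⟨fun a => (f a.rev).rev, ?_, ?_⟩
  · intro a b hab
    simp only [Fin.rev_lt_rev]
    exact hf (by simpa using hab)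
  · intro a b
    have := hf' b.rev a.rev
    simpa [pattern123] using this

lemma PcountZ_symm (n : ℕ) (j k : ℤ) : PcountZ n j k = PcountZ n (n + 1 - j) (n + 1 - k) := by
  unfold PcountZ
  apply Nat.card_congr
  have aux : ∀ (j k : ℤ) (σ : Equiv.Perm (Fin n)),
      (Avoids σ pattern123 ∧ ∃ i : Fin n, ((i : ℕ) : ℤ) + 1 = j ∧ ((σ i : ℕ) : ℤ) + 1 = k) →
      (Avoids (Fin.revPerm.trans (σ.trans Fin.revPerm)) pattern123 ∧
        ∃ i : Fin n, ((i : ℕ) : ℤ) + 1 = n + 1 - j ∧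
          (((Fin.revPerm.trans (σ.trans Fin.revPerm)) i : ℕ) : ℤ) + 1 = n + 1 - k) := by
    rintro j k σ ⟨h1, i, h2, h3⟩
    refine ⟨Q_rev σ h1, i.rev, ?_, ?_⟩
    · simp only [Fin.val_rev]; omega
    · simp only [Equiv.trans_apply, Fin.revPerm_apply, Fin.rev_rev, Fin.val_rev]; omega
  refine ⟨fun x => ⟨_, aux j k x.1 x.2⟩, fun x => ⟨Fin.revPerm.trans (x.1.trans Fin.revPerm), by
    have := aux _ _ x.1 x.2
    rwa [sub_sub_cancel, sub_sub_cancel] at this⟩, ?_, ?_⟩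
  · intro x
    ext : 2
    simp
  · intro x
    ext : 2
    simp

end PC

namespace PC

lemma phi_bound (t : ℝ) (ht : |t| ≤ 1/2) :
    |(1 - t) * Real.log (1 - t) + (1 + t) * Real.log (1 + t) - t^2| ≤ 6 * |t|^3 := by
  have h1 := Real.abs_log_sub_add_sum_range_le (x := t) (by linarith) 2
  have h2 := Real.abs_log_sub_add_sum_range_le (x := -t) (by rw [abs_neg]; linarith) 2
  rw [abs_neg] at h2
  simp only [Finset.sum_range_succ, Finset.sum_range_zero] at h1 h2
  norm_num at h1 h2
  have hb : |t|^3 / (1 - |t|) ≤ 2 * |t|^3 := by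
    rw [div_le_iff₀ (by linarith)]
    have : 0 ≤ |t|^3 := by positivity
    nlinarith
  have h1' := h1.trans hb
  have h2' := h2.trans hb
  obtain ⟨ht1, ht2⟩ := abs_le.mp ht
  set u := Real.log (1 - t)
  set v := Real.log (1 + t)
  have e : (1 - t) * u + (1 + t) * v - t^2
      = (1 - t) * (t + t^2/2 + u) + (1 + t) * (-t + t^2/2 + v) := by ring
  rw [e]
  refine (abs_add_le _ _).trans ?_
  rw [abs_mul, abs_mul, abs_of_nonneg (show 0 ≤ 1 - t by linarith),
    abs_of_nonneg (show 0 ≤ 1 + t by linarith)]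
  have a1 := mul_le_mul_of_nonneg_left h1' (show 0 ≤ 1 - t by linarith)
  have a2 := mul_le_mul_of_nonneg_left h2' (show 0 ≤ 1 + t by linarith)
  have : 0 ≤ |t|^3 := by positivity
  nlinarith

lemma fact_eq (n : ℕ) (hn : 0 < n) :
    (n.factorial : ℝ) = Stirling.stirlingSeq n * (Real.sqrt (2 * n) * (n / Real.exp 1) ^ n) := by
  unfold Stirling.stirlingSeq
  have : (0:ℝ) < n := by exact_mod_cast hn
  field_simp

lemma pow_eq_exp (n : ℕ) (hn : 0 < n) :
    ((n : ℝ) / Real.exp 1) ^ n = Real.exp (n * Real.log n - n) := by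
  have : (0:ℝ) < n := by exact_mod_cast hn
  rw [Real.exp_sub, div_pow, ← Real.exp_nat_mul, mul_one, mul_comm, Real.exp_mul, Real.exp_log this,
    Real.rpow_natCast]

/-- exact Stirling form of the binomial -/
lemma choose_stirling (n x y : ℕ) (hn : 0 < n) (hx : 0 < x) (hy : 0 < y) :
    Real.sqrt n * ((x + y).choose x : ℝ) / 2 ^ (x + y) =
      Stirling.stirlingSeq (x + y) / (Stirling.stirlingSeq x * Stirling.stirlingSeq y) *
      Real.sqrt (((x / n : ℝ) + (y / n : ℝ)) / (2 * (x / n : ℝ) * (y / n : ℝ))) *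
      Real.exp (-(((x : ℝ) + y) / 2 *
        ((1 - ((y : ℝ) - x) / (x + y)) * Real.log (1 - ((y : ℝ) - x) / (x + y)) +
        (1 + ((y : ℝ) - x) / (x + y)) * Real.log (1 + ((y : ℝ) - x) / (x + y))))) := by
  have hn' : (0:ℝ) < n := by exact_mod_cast hn
  have hx' : (0:ℝ) < x := by exact_mod_cast hx
  have hy' : (0:ℝ) < y := by exact_mod_cast hy
  have hS : ∀ m : ℕ, 0 < m → 0 < Stirling.stirlingSeq m := by
    intro m hm
    obtain ⟨m, rfl⟩ : ∃ k, m = k + 1 := ⟨m - 1, by omega⟩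
    exact Stirling.stirlingSeq'_pos m
  have hc : ((x + y).choose x : ℝ) = (x+y).factorial / (x.factorial * y.factorial) := by
    rw [Nat.cast_add_choose]
  have h1 : 1 - ((y : ℝ) - x) / (x + y) = 2 * x / (x + y) := by field_simp; ring
  have h2 : 1 + ((y : ℝ) - x) / (x + y) = 2 * y / (x + y) := by field_simp; ring
  have hE : Real.exp (-(((x : ℝ) + y) / 2 *
        ((1 - ((y : ℝ) - x) / (x + y)) * Real.log (1 - ((y : ℝ) - x) / (x + y)) +
        (1 + ((y : ℝ) - x) / (x + y)) * Real.log (1 + ((y : ℝ) - x) / (x + y)))))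
      = Real.exp (((x+y:ℕ):ℝ) * Real.log ((x+y:ℕ):ℝ) - ((x+y:ℕ):ℝ)) /
        (Real.exp (x * Real.log x - x) * Real.exp (y * Real.log y - y)) / 2 ^ (x + y) := by
    have h2p : (2:ℝ)^(x+y) = Real.exp ((x + y) * Real.log 2) := by
      rw [mul_comm, Real.exp_mul, Real.exp_log (by norm_num), ← Real.rpow_natCast]; push_cast; rfl
    rw [h2p, ← Real.exp_add, ← Real.exp_sub, ← Real.exp_sub, h1, h2,
      Real.log_div (by positivity) (by positivity), Real.log_div (by positivity) (by positivity),
      Real.log_mul (by norm_num) (by positivity), Real.log_mul (by norm_num) (by positivity)]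
    congr 1
    push_cast
    field_simp
    ring
  have hR : Real.sqrt (((x / n : ℝ) + (y / n : ℝ)) / (2 * (x / n : ℝ) * (y / n : ℝ)))
      = Real.sqrt n * Real.sqrt (2 * ((x + y : ℕ):ℝ)) / (Real.sqrt (2 * x) * Real.sqrt (2 * y)) := by
    rw [← Real.sqrt_mul (by positivity), ← Real.sqrt_mul (by positivity),
      ← Real.sqrt_div (by positivity)]
    congr 1
    push_cast
    field_simp
  rw [hE, hR, hc, fact_eq _ hx, fact_eq _ hy, fact_eq (x+y) (by omega), pow_eq_exp _ hx,
    pow_eq_exp _ hy, pow_eq_exp (x+y) (by omega)]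
  have := hS x hx
  have := hS y hy
  have : 0 < Real.sqrt (2 * x) := by positivity
  have : 0 < Real.sqrt (2 * y) := by positivity
  field_simp

lemma sqrt_atTop : Tendsto (fun n : ℕ => Real.sqrt n) atTop atTop :=
  Real.tendsto_sqrt_atTop.comp tendsto_natCast_atTop_atTop

lemma inv_sqrt_lim : Tendsto (fun n : ℕ => (Real.sqrt n)⁻¹) atTop (nhds 0) :=
  tendsto_inv_atTop_zero.comp sqrt_atTop

lemma nat_atTop {x : ℕ → ℕ} {β : ℝ} (hβ : 0 < β)
    (hx : Tendsto (fun n : ℕ => (x n : ℝ) / n) atTop (nhds β)) : Tendsto x atTop atTop := by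
  rw [← tendsto_natCast_atTop_iff (R := ℝ)]
  have h := hx.pos_mul_atTop hβ (tendsto_natCast_atTop_atTop (R := ℝ))
  refine h.congr' ?_
  filter_upwards [eventually_gt_atTop 0] with n hn
  have : (0:ℝ) < n := by exact_mod_cast hn
  field_simp

lemma lclt (x y : ℕ → ℕ) (β δ : ℝ) (hβ : 0 < β)
    (hx : Tendsto (fun n : ℕ => (x n : ℝ) / n) atTop (nhds β))
    (hy : Tendsto (fun n : ℕ => (y n : ℝ) / n) atTop (nhds β))
    (hd : Tendsto (fun n : ℕ => ((y n : ℝ) - x n) / Real.sqrt n) atTop (nhds δ)) :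
    Tendsto (fun n : ℕ => Real.sqrt n * ((x n + y n).choose (x n) : ℝ) / 2 ^ (x n + y n)) atTop
      (nhds (1 / Real.sqrt (π * β) * Real.exp (-(δ^2 / (4 * β))))) := by
  have hxT := nat_atTop hβ hx
  have hyT := nat_atTop hβ hy
  have hLT : Tendsto (fun n => x n + y n) atTop atTop := hxT.atTop_add_nonneg (fun _ => Nat.zero_le _)
  have hS := Stirling.tendsto_stirlingSeq_sqrt_pi
  have hpi : 0 < Real.sqrt π := Real.sqrt_pos.mpr Real.pi_pos
  have A := (hS.comp hLT).div ((hS.comp hxT).mul (hS.comp hyT)) (by positivity)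
  have B : Tendsto (fun n : ℕ => Real.sqrt (((x n / n : ℝ) + (y n / n : ℝ)) /
      (2 * (x n / n : ℝ) * (y n / n : ℝ)))) atTop (nhds (Real.sqrt ((β + β) / (2 * β * β)))) := by
    apply Tendsto.sqrt
    exact (hx.add hy).div ((hx.const_mul 2).mul hy) (by positivity)
  -- t² L → δ²/(2β)
  set t : ℕ → ℝ := fun n => ((y n : ℝ) - x n) / (x n + y n) with ht
  have hn0 : ∀ᶠ n : ℕ in atTop, 0 < n ∧ 0 < x n ∧ 0 < y n :=
    (eventually_gt_atTop 0).and ((hxT.eventually_gt_atTop 0).and (hyT.eventually_gt_atTop 0))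
  have hLt : Tendsto (fun n => ((x n : ℝ) + y n) / 2 * (t n)^2) atTop (nhds (δ^2 / (4 * β))) := by
    have : Tendsto (fun n : ℕ => (((y n : ℝ) - x n) / Real.sqrt n)^2 /
      (2 * ((x n : ℝ) / n + (y n : ℝ) / n))) atTop (nhds (δ^2 / (2 * (β + β)))) :=
      (hd.pow 2).div ((hx.add hy).const_mul 2) (by positivity)
    rw [show 4 * β = 2 * (β + β) by ring]
    refine this.congr' ?_
    filter_upwards [hn0] with n ⟨hn, hx, hy⟩
    have hn' : (0:ℝ) < n := by exact_mod_cast hn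
    have hx' : (0:ℝ) < x n := by exact_mod_cast hx
    have hy' : (0:ℝ) < y n := by exact_mod_cast hy
    simp only [ht]
    rw [div_pow, Real.sq_sqrt hn'.le]
    field_simp
  have ht0 : Tendsto t atTop (nhds 0) := by
    have : Tendsto (fun n : ℕ => (((y n : ℝ) - x n) / Real.sqrt n) * (Real.sqrt n)⁻¹ /
      ((x n : ℝ) / n + (y n : ℝ) / n)) atTop (nhds (δ * 0 / (β + β))) :=
      (hd.mul inv_sqrt_lim).div (hx.add hy) (by positivity)
    rw [mul_zero, zero_div] at this
    refine this.congr' ?_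
    filter_upwards [hn0] with n ⟨hn, hx, hy⟩
    have hn' : (0:ℝ) < n := by exact_mod_cast hn
    have hx' : (0:ℝ) < x n := by exact_mod_cast hx
    have hy' : (0:ℝ) < y n := by exact_mod_cast hy
    simp only [ht]
    have e : ((y n : ℝ) - x n) / Real.sqrt n * (Real.sqrt n)⁻¹ = ((y n : ℝ) - x n) / n := by
      rw [← div_eq_mul_inv, div_div, Real.mul_self_sqrt hn'.le]
    rw [e]
    field_simp
  have hE : Tendsto (fun n => ((x n : ℝ) + y n) / 2 *
      ((1 - t n) * Real.log (1 - t n) + (1 + t n) * Real.log (1 + t n))) atTop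
      (nhds (δ^2 / (4 * β))) := by
    have hz : Tendsto (fun n => ((x n : ℝ) + y n) / 2 *
      ((1 - t n) * Real.log (1 - t n) + (1 + t n) * Real.log (1 + t n) - (t n)^2)) atTop
      (nhds 0) := by
      have hb : Tendsto (fun n => 6 * (((x n : ℝ) + y n) / 2 * (t n)^2) * |t n|) atTop (nhds 0) := by
        have := (hLt.const_mul 6).mul ht0.abs
        simpa using this
      refine squeeze_zero_norm' ?_ hb
      have hsm : ∀ᶠ n in atTop, |t n| ≤ 1/2 := by
        have := ht0.abs
        rw [abs_zero] at this
        exact this.eventually_le_const (by norm_num)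
      filter_upwards [hsm] with n hn
      rw [Real.norm_eq_abs, abs_mul, abs_of_nonneg (show (0:ℝ) ≤ ((x n : ℝ) + y n)/2 by positivity)]
      have := mul_le_mul_of_nonneg_left (phi_bound (t n) hn)
        (show (0:ℝ) ≤ ((x n : ℝ) + y n)/2 by positivity)
      refine this.trans (le_of_eq ?_)
      rw [← sq_abs (t n)]
      ring
    have := hz.add hLt
    rw [zero_add] at this
    refine this.congr fun n => ?_
    ring
  have F := (A.mul B).mul (Real.continuous_exp.continuousAt.tendsto.comp hE.neg)
  have hval : 1 / Real.sqrt (π * β) = √π / (√π * √π) * √((β + β) / (2 * β * β)) := by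
    rw [show (β + β) / (2 * β * β) = 1 / β by field_simp; ring, Real.sqrt_mul Real.pi_pos.le,
      Real.sqrt_div zero_le_one, Real.sqrt_one]
    have : 0 < √β := Real.sqrt_pos.mpr hβ
    field_simp
  rw [hval]
  refine F.congr' ?_
  filter_upwards [hn0] with n ⟨hn, hx, hy⟩
  rw [choose_stirling n (x n) (y n) hn hx hy]
  rfl

lemma diff_eq (x y : ℕ) : ((x + y).choose x : ℝ) - ((x + y).choose (y+1) : ℝ)
    = (x + y).choose x * (((y:ℝ) - x + 1) / (y + 1)) := by
  have h := Nat.choose_succ_right_eq (x + y) y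
  rw [Nat.add_sub_cancel, ← Nat.choose_symm_add] at h
  have h' : ((x + y).choose (y+1) : ℝ) * (y + 1) = (x+y).choose x * x := by exact_mod_cast h
  field_simp
  linear_combination -h'

lemma wlim (x y : ℕ → ℕ) (β δ : ℝ) (hβ : 0 < β)
    (hx : Tendsto (fun n : ℕ => (x n : ℝ) / n) atTop (nhds β))
    (hy : Tendsto (fun n : ℕ => (y n : ℝ) / n) atTop (nhds β))
    (hd : Tendsto (fun n : ℕ => ((y n : ℝ) - x n) / Real.sqrt n) atTop (nhds δ)) :
    Tendsto (fun n : ℕ => (n : ℝ) * (((x n + y n).choose (x n) : ℝ) -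
        ((x n + y n).choose (y n + 1) : ℝ)) / 2 ^ (x n + y n)) atTop
      (nhds (1 / Real.sqrt (π * β) * Real.exp (-(δ^2 / (4 * β))) * (δ / β))) := by
  have h1 := lclt x y β δ hβ hx hy hd
  have hin : Tendsto (fun n : ℕ => ((n : ℝ))⁻¹) atTop (nhds 0) :=
    tendsto_inv_atTop_zero.comp tendsto_natCast_atTop_atTop
  have h2 : Tendsto (fun n : ℕ => (((y n : ℝ) - x n) / Real.sqrt n + (Real.sqrt n)⁻¹) /
      ((y n : ℝ) / n + (n : ℝ)⁻¹)) atTop (nhds ((δ + 0) / (β + 0))) :=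
    (hd.add inv_sqrt_lim).div (hy.add hin) (by simpa using hβ.ne')
  rw [add_zero, add_zero] at h2
  refine (h1.mul h2).congr' ?_
  filter_upwards [eventually_gt_atTop 0] with n hn
  have hn' : (0:ℝ) < n := by exact_mod_cast hn
  have hs : 0 < Real.sqrt n := Real.sqrt_pos.mpr hn'
  have hss : Real.sqrt n ^ 2 = n := Real.sq_sqrt hn'.le
  rw [diff_eq]
  field_simp

lemma w_real1 (x y : ℕ) : (w y x y : ℝ) = ((x + y).choose x : ℝ) - ((x + y).choose (y+1) : ℝ) := by
  unfold w
  push_cast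
  rw [Nat.choose_symm_add]

lemma w_real2 (x y : ℕ) : (w y y x : ℝ) = ((x + y).choose x : ℝ) - ((x + y).choose (y+1) : ℝ) := by
  unfold w
  push_cast
  rw [add_comm y x]

lemma div_lim (f : ℕ → ℝ) (b c : ℝ)
    (h : Tendsto (fun n : ℕ => (f n - b * n) / Real.sqrt n) atTop (nhds c)) :
    Tendsto (fun n : ℕ => f n / n) atTop (nhds b) := by
  have := (h.mul inv_sqrt_lim).add_const b
  rw [mul_zero, zero_add] at this
  refine this.congr' ?_
  filter_upwards [eventually_gt_atTop 0] with n hn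
  have hn' : (0:ℝ) < n := by exact_mod_cast hn
  rw [← div_eq_mul_inv, div_div, Real.mul_self_sqrt hn'.le]
  field_simp
  ring

lemma core (b c : ℝ) (hb0 : 0 < b) (hb1 : b < 1) (hc : 0 < c) (J K : ℕ → ℕ)
    (hJ : Tendsto (fun n : ℕ => ((J n : ℝ) - b * n) / Real.sqrt n) atTop (nhds (-c)))
    (hK : Tendsto (fun n : ℕ => ((K n : ℝ) - (1 - b) * n) / Real.sqrt n) atTop (nhds (-c))) :
    Tendsto (fun n : ℕ => Real.sqrt n * (PcountZ n (J n + 1) (K n + 1) : ℝ) / (catalan n : ℝ))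
      atTop (nhds (c ^ 2 / (Real.sqrt π * (b * (1 - b)) ^ ((3 : ℝ) / 2)) *
        Real.exp (-c ^ 2 / (b * (1 - b))))) := by
  have hb2 : 0 < 1 - b := by linarith
  have hin : Tendsto (fun n : ℕ => ((n : ℝ))⁻¹) atTop (nhds 0) :=
    tendsto_inv_atTop_zero.comp tendsto_natCast_atTop_atTop
  have hJn := div_lim _ _ _ hJ
  have hKn := div_lim _ _ _ hK
  have hD : Tendsto (fun n : ℕ => ((n : ℝ) - 1 - J n - K n) / Real.sqrt n) atTop (nhds (2 * c)) := by
    have := ((hJ.add hK).neg).sub inv_sqrt_lim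
    rw [show -(-c + -c) - 0 = 2 * c by ring] at this
    refine this.congr fun n => ?_
    rw [inv_eq_one_div]
    ring
  have hev : ∀ᶠ n : ℕ in atTop, 0 < n ∧ J n + K n + 1 ≤ n := by
    filter_upwards [eventually_gt_atTop 0, hD.eventually_const_lt (show 0 < 2 * c by linarith)] with n hn h
    refine ⟨hn, ?_⟩
    have hn' : (0:ℝ) < n := by exact_mod_cast hn
    have hs : 0 < Real.sqrt n := Real.sqrt_pos.mpr hn'
    have h3 : (0:ℝ) < (n : ℝ) - 1 - J n - K n := by
      by_contra hcon
      have := div_nonpos_of_nonpos_of_nonneg (not_lt.mp hcon) hs.le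
      linarith
    have : ((J n + K n + 1 : ℕ) : ℝ) < n := by push_cast; linarith
    exact le_of_lt (by exact_mod_cast this)
  have hy1 : Tendsto (fun n : ℕ => ((n - 1 - J n : ℕ) : ℝ) / n) atTop (nhds (1 - b)) := by
    have := (hJn.const_sub 1).sub hin
    rw [sub_zero] at this
    refine this.congr' ?_
    filter_upwards [hev] with n ⟨hn, h⟩
    have hn' : (0:ℝ) < n := by exact_mod_cast hn
    rw [Nat.cast_sub (by omega), Nat.cast_sub (by omega)]
    field_simp
    push_cast
    ring
  have hy2 : Tendsto (fun n : ℕ => ((n - 1 - K n : ℕ) : ℝ) / n) atTop (nhds b) := by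
    have := (hKn.const_sub 1).sub hin
    rw [sub_zero, sub_sub_cancel] at this
    refine this.congr' ?_
    filter_upwards [hev] with n ⟨hn, h⟩
    have hn' : (0:ℝ) < n := by exact_mod_cast hn
    rw [Nat.cast_sub (by omega), Nat.cast_sub (by omega)]
    field_simp
    push_cast
    ring
  have hd1 : Tendsto (fun n : ℕ => (((n - 1 - J n : ℕ) : ℝ) - K n) / Real.sqrt n) atTop
      (nhds (2 * c)) := by
    refine hD.congr' ?_
    filter_upwards [hev] with n ⟨hn, h⟩
    rw [Nat.cast_sub (by omega), Nat.cast_sub (by omega)]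
    push_cast
    ring
  have hd2 : Tendsto (fun n : ℕ => (((n - 1 - K n : ℕ) : ℝ) - J n) / Real.sqrt n) atTop
      (nhds (2 * c)) := by
    refine hD.congr' ?_
    filter_upwards [hev] with n ⟨hn, h⟩
    rw [Nat.cast_sub (by omega), Nat.cast_sub (by omega)]
    push_cast
    ring
  have W1 := wlim K (fun n => n - 1 - J n) (1 - b) (2 * c) hb2 hKn hy1 hd1
  have W2 := wlim J (fun n => n - 1 - K n) b (2 * c) hb0 hJn hy2 hd2
  have hid : Tendsto (fun n : ℕ => (n : ℝ) / n) atTop (nhds 1) := by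
    refine tendsto_const_nhds.congr' ?_
    filter_upwards [eventually_gt_atTop 0] with n hn
    have hn' : (0:ℝ) < n := by exact_mod_cast hn
    field_simp
  have Cn := lclt (fun n => n) (fun n => n) 1 0 one_pos hid hid (by simp)
  have F := ((W1.mul W2).mul (((hid.add hin).const_mul (1/4)))).div Cn (by
    rw [mul_one]
    have := Real.sqrt_pos.mpr Real.pi_pos
    positivity)
  have hval : c ^ 2 / (Real.sqrt π * (b * (1 - b)) ^ ((3 : ℝ) / 2)) *
        Real.exp (-c ^ 2 / (b * (1 - b))) =
      1 / √(π * (1 - b)) * rexp (-((2 * c) ^ 2 / (4 * (1 - b)))) * (2 * c / (1 - b)) *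
            (1 / √(π * b) * rexp (-((2 * c) ^ 2 / (4 * b))) * (2 * c / b)) *
          (1 / 4 * (1 + 0)) /
        (1 / √(π * 1) * rexp (-(0 ^ 2 / (4 * 1)))) := by
    have hbb : 0 < b * (1 - b) := by positivity
    have e1 : (b * (1 - b)) ^ ((3 : ℝ) / 2) = b * (1 - b) * (√b * √(1-b)) := by
      rw [show (3:ℝ)/2 = 1 + 1/2 by norm_num, Real.rpow_add hbb, Real.rpow_one,
        ← Real.sqrt_eq_rpow, Real.sqrt_mul hb0.le]
    have e2 : Real.exp (-c ^ 2 / (b * (1 - b))) =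
        rexp (-((2 * c) ^ 2 / (4 * (1 - b)))) * rexp (-((2 * c) ^ 2 / (4 * b))) := by
      rw [← Real.exp_add]
      congr 1
      field_simp
      ring
    have e3 : rexp (-(0 ^ 2 / (4 * 1))) = 1 := by simp
    rw [e1, e2, e3, Real.sqrt_mul Real.pi_pos.le, Real.sqrt_mul Real.pi_pos.le, mul_one π]
    have := Real.sqrt_pos.mpr Real.pi_pos
    have := Real.sqrt_pos.mpr hb0
    have := Real.sqrt_pos.mpr hb2
    field_simp
    ring
  rw [hval]
  refine F.congr' ?_
  filter_upwards [hev] with n ⟨hn, h⟩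
  have hP : (PcountZ n (J n + 1) (K n + 1) : ℝ) =
      (w (n - 1 - J n) (K n) (n - 1 - J n) : ℝ) * (w (n - 1 - K n) (n - 1 - K n) (J n) : ℝ) := by
    exact_mod_cast PcountZ_eq n (J n) (K n) h
  have hcat : (catalan n : ℝ) = ((n + n).choose n : ℝ) / (n + 1) := by
    have := succ_mul_catalan_eq_centralBinom n
    have h' : ((n:ℝ) + 1) * catalan n = Nat.centralBinom n := by exact_mod_cast this
    rw [Nat.centralBinom_eq_two_mul_choose, two_mul] at h'
    rw [← h']
    field_simp
  have hCpos : (0:ℝ) < ((n + n).choose n : ℝ) := by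
    exact_mod_cast Nat.choose_pos (by omega)
  have hpow : (2:ℝ)^(n+n) = 4 * (2 ^ (K n + (n - 1 - J n)) * 2 ^ (J n + (n - 1 - K n))) := by
    rw [← pow_add, show (4:ℝ) = 2^2 by norm_num, ← pow_add]
    congr 1
    omega
  rw [hP, hcat, w_real1, w_real2]
  have hn' : (0:ℝ) < n := by exact_mod_cast hn
  have hs : 0 < Real.sqrt n := Real.sqrt_pos.mpr hn'
  have hss : Real.sqrt n ^ 2 = n := Real.sq_sqrt hn'.le
  simp only [Pi.div_apply]
  rw [hpow]
  generalize ((K n + (n - 1 - J n)).choose (K n) : ℝ) -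
    ((K n + (n - 1 - J n)).choose (n - 1 - J n + 1) : ℝ) = A
  generalize ((J n + (n - 1 - K n)).choose (J n) : ℝ) -
    ((J n + (n - 1 - K n)).choose (n - 1 - K n + 1) : ℝ) = B
  field_simp
  try rw [hss]
  try ring

lemma core_int (b c : ℝ) (hb0 : 0 < b) (hb1 : b < 1) (hc : 0 < c) (j k : ℕ → ℤ)
    (hJ : Tendsto (fun n : ℕ => ((j n : ℝ) - b * n) / Real.sqrt n) atTop (nhds (-c)))
    (hK : Tendsto (fun n : ℕ => ((k n : ℝ) - (1 - b) * n) / Real.sqrt n) atTop (nhds (-c))) :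
    Tendsto (fun n : ℕ => Real.sqrt n * (PcountZ n (j n) (k n) : ℝ) / (catalan n : ℝ))
      atTop (nhds (c ^ 2 / (Real.sqrt π * (b * (1 - b)) ^ ((3 : ℝ) / 2)) *
        Real.exp (-c ^ 2 / (b * (1 - b))))) := by
  have pos : ∀ (f : ℕ → ℤ) (b : ℝ), 0 < b →
      Tendsto (fun n : ℕ => ((f n : ℝ) - b * n) / Real.sqrt n) atTop (nhds (-c)) →
      ∀ᶠ n in atTop, 1 ≤ f n := by
    intro f b hb h
    have h1 := div_lim _ _ _ h
    filter_upwards [h1.eventually_const_lt hb] with n hn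
    by_contra hcon
    have h2 : (f n : ℝ) ≤ 0 := by exact_mod_cast (show f n ≤ 0 by omega)
    have := div_nonpos_of_nonpos_of_nonneg h2 (Nat.cast_nonneg (α := ℝ) n)
    linarith
  have shift : ∀ (f : ℕ → ℤ) (b : ℝ), 0 < b →
      Tendsto (fun n : ℕ => ((f n : ℝ) - b * n) / Real.sqrt n) atTop (nhds (-c)) →
      Tendsto (fun n : ℕ => ((((f n - 1).toNat : ℕ) : ℝ) - b * n) / Real.sqrt n) atTop
        (nhds (-c)) := by
    intro f b hb h
    have := h.sub inv_sqrt_lim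
    rw [sub_zero] at this
    refine this.congr' ?_
    filter_upwards [pos f b hb h] with n hn
    have e : (((f n - 1).toNat : ℕ) : ℝ) = (f n : ℝ) - 1 := by
      have : (((f n - 1).toNat : ℕ) : ℤ) = f n - 1 := by omega
      exact_mod_cast congrArg (Int.cast : ℤ → ℝ) this
    rw [e, inv_eq_one_div]
    ring
  have := core b c hb0 hb1 hc _ _ (shift j b hb0 hJ) (shift k (1-b) (by linarith) hK)
  refine this.congr' ?_
  filter_upwards [pos j b hb0 hJ, pos k (1-b) (by linarith) hK] with n h1 h2
  rw [show (((j n - 1).toNat : ℕ) : ℤ) + 1 = j n by omega,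
    show (((k n - 1).toNat : ℕ) : ℤ) + 1 = k n by omega]

lemma near (f : ℕ → ℝ) (b c : ℝ) (h : ∀ n, |f n - (b * n - c * Real.sqrt n)| ≤ 2) :
    Tendsto (fun n : ℕ => (f n - b * n) / Real.sqrt n) atTop (nhds (-c)) := by
  have h0 : Tendsto (fun n : ℕ => (f n - (b * n - c * Real.sqrt n)) / Real.sqrt n) atTop
      (nhds 0) := by
    have h2 := inv_sqrt_lim.const_mul 2
    rw [mul_zero] at h2
    refine squeeze_zero_norm (fun n => ?_) h2
    rw [Real.norm_eq_abs, abs_div, abs_of_nonneg (Real.sqrt_nonneg _), ← div_eq_mul_inv]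
    exact div_le_div_of_nonneg_right (h n) (Real.sqrt_nonneg _)
  have := h0.sub_const c
  rw [zero_sub] at this
  refine this.congr' ?_
  filter_upwards [eventually_gt_atTop 0] with n hn
  have hn' : (0:ℝ) < n := by exact_mod_cast hn
  have hs : 0 < Real.sqrt n := Real.sqrt_pos.mpr hn'
  field_simp
  ring

end PC

/-- At distance `c√n` from the anti-diagonal,
`√n · P_n(⌊an - c√n⌋, ⌊(1-a)n - c√n⌋)/C_n → (c²/(√π (a(1-a))^{3/2})) e^{-c²/(a(1-a))}`. -/
theorem Pcount_sqrt_scale_limit (a : ℝ) (ha0 : 0 < a) (ha1 : a < 1)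
    (c : ℝ) (hc : c ≠ 0) :
    Tendsto (fun n : ℕ =>
        (n : ℝ) ^ ((1 : ℝ) / 2) *
          (PcountZ n ⌊a * n - c * Real.sqrt n⌋ ⌊(1 - a) * n - c * Real.sqrt n⌋ : ℝ) /
          (catalan n : ℝ))
      atTop
      (nhds (c ^ 2 / (Real.sqrt π * (a * (1 - a)) ^ ((3 : ℝ) / 2)) *
        Real.exp (-c ^ 2 / (a * (1 - a))))) := by
  simp only [← Real.sqrt_eq_rpow]
  rcases lt_or_gt_of_ne hc with h | h
  · have := PC.core_int (1 - a) (-c) (by linarith) (by linarith) (by linarith)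
      (fun n => n + 1 - ⌊a * n - c * Real.sqrt n⌋) (fun n => n + 1 - ⌊(1 - a) * n - c * Real.sqrt n⌋)
      (PC.near _ _ _ fun n => by
        have h1 := Int.floor_le (a * n - c * Real.sqrt n)
        have h2 := Int.lt_floor_add_one (a * n - c * Real.sqrt n)
        push_cast
        rw [abs_le]
        constructor <;> linarith)
      (PC.near _ _ _ fun n => by
        have h1 := Int.floor_le ((1 - a) * n - c * Real.sqrt n)
        have h2 := Int.lt_floor_add_one ((1 - a) * n - c * Real.sqrt n)
        push_cast
        rw [abs_le]
        constructor <;> linarith)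
    rw [sub_sub_cancel, neg_sq, mul_comm (1 - a) a] at this
    refine this.congr fun n => ?_
    rw [← PC.PcountZ_symm]
  · exact PC.core_int a c ha0 ha1 h _ _
      (PC.near _ _ _ fun n => by
        have h1 := Int.floor_le (a * n - c * Real.sqrt n)
        have h2 := Int.lt_floor_add_one (a * n - c * Real.sqrt n)
        rw [abs_le]
        constructor <;> linarith)
      (PC.near _ _ _ fun n => by
        have h1 := Int.floor_le ((1 - a) * n - c * Real.sqrt n)
        have h2 := Int.lt_floor_add_one ((1 - a) * n - c * Real.sqrt n)
        rw [abs_le]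
        constructor <;> linarith)
end

section
/- (i) Let a, b ∈ (0,1) with a + b < 1, let c ∈ ℝ, and let α ∈ (0,1). Then there exist ε ∈ (0,1) and N such that for all n > N, Q_n(⌊an − c·n^α⌋, ⌊bn − c·n^α⌋) / C_n < ε^n. (ii) Let a ∈ (0,1), c > 0, and α ∈ (1/2, 1). Then there exist ε ∈ (0,1) and N such that for all n > N, Q_n(⌊an − c·n^α⌋, ⌊(1−a)n − c·n^α⌋) / C_n < ε^{n^{2α−1}}. -/
open Filter Finset Real

/-- `Q_n(j,k)` with integer arguments: the number of 132-avoiding permutations of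
`{1,…,n}` with value `k` in position `j` (1-indexed); `0` when `j` or `k` is out of
range. -/
noncomputable def QcountZ (n : ℕ) (j k : ℤ) : ℕ :=
  Nat.card {σ : Equiv.Perm (Fin n) //
    Avoids σ pattern132 ∧ ∃ i : Fin n, ((i : ℕ) : ℤ) + 1 = j ∧ ((σ i : ℕ) : ℤ) + 1 = k}

/-- `h_i`: the number of later, larger entries. -/
def hgt {n : ℕ} (σ : Equiv.Perm (Fin n)) (i : Fin n) : ℕ :=
  (univ.filter (fun v : Fin n => σ i < v ∧ i < σ.symm v)).card

lemma hgt_inj {n : ℕ} (σ τ : Equiv.Perm (Fin n)) (h : ∀ i, hgt σ i = hgt τ i) : σ = τ := by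
  have key : ∀ (σ τ : Equiv.Perm (Fin n)) (i : Fin n), (∀ l < i, σ l = τ l) → σ i < τ i →
      hgt τ i < hgt σ i := by
    intro σ τ i hl hlt
    apply Finset.card_lt_card
    rw [Finset.ssubset_iff_of_subset]
    · refine ⟨τ i, ?_, ?_⟩
      · simp only [Finset.mem_filter, Finset.mem_univ, true_and]
        refine ⟨hlt, ?_⟩
        by_contra hc
        rcases lt_or_eq_of_le (not_lt.mp hc) with h1 | h1
        · have h2 := hl _ h1
          rw [Equiv.apply_symm_apply] at h2
          have := τ.injective h2
          rw [← this] at h1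
          exact lt_irrefl _ h1
        · have h2 : τ i = σ i := by
            have h3 := congrArg σ h1
            rwa [Equiv.apply_symm_apply] at h3
          rw [h2] at hlt
          exact lt_irrefl _ hlt
      · simp
    · intro v hv
      simp only [Finset.mem_filter, Finset.mem_univ, true_and] at hv ⊢
      refine ⟨hlt.trans hv.1, ?_⟩
      by_contra hc
      rcases lt_or_eq_of_le (not_lt.mp hc) with h1 | h1
      · have h2 := hl _ h1
        rw [Equiv.apply_symm_apply] at h2
        have h3 := hv.2
        rw [h2, Equiv.symm_apply_apply] at h3
        exact lt_asymm h1 h3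
      · have h2 : v = σ i := by rw [← h1]; simp
        rw [h2] at hv
        exact lt_asymm hlt hv.1
  have : ∀ m : ℕ, ∀ i : Fin n, (i : ℕ) = m → σ i = τ i := by
    intro m
    induction m using Nat.strong_induction_on with
    | _ m ih =>
      intro i hi
      have hl : ∀ l < i, σ l = τ l := fun l hli => ih l (by rw [← hi]; exact hli) l rfl
      rcases lt_trichotomy (σ i) (τ i) with h1 | h1 | h1
      · have := key σ τ i hl h1
        rw [h i] at this
        exact absurd this (lt_irrefl _)
      · exact h1
      · have := key τ σ i (fun l hli => (hl l hli).symm) h1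
        rw [h i] at this
        exact absurd this (lt_irrefl _)
  ext i
  rw [this i i rfl]

lemma hgt_le {n : ℕ} (σ : Equiv.Perm (Fin n)) (i : Fin n) : hgt σ i + (i + 1) ≤ n := by
  have : hgt σ i ≤ (Finset.Ioi i).card := by
    apply Finset.card_le_card_of_injOn σ.symm
    · intro v hv
      simp at hv ⊢
      exact hv.2
    · exact σ.symm.injective.injOn
  rw [Fin.card_Ioi] at this
  have := i.2
  omega

lemma hgt_ge {n : ℕ} (σ : Equiv.Perm (Fin n)) (i : Fin n) :
    n ≤ hgt σ i + i + (σ i + 1) := by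
  have h1 : (Finset.Ioi (σ i)) ⊆
      (univ.filter (fun v : Fin n => σ i < v ∧ i < σ.symm v)) ∪ (Finset.Iio i).image σ := by
    intro v hv
    simp only [Finset.mem_Ioi, Finset.mem_union, Finset.mem_filter, Finset.mem_univ, true_and,
      Finset.mem_image, Finset.mem_Iio] at hv ⊢
    rcases lt_trichotomy i (σ.symm v) with h | h | h
    · exact Or.inl ⟨hv, h⟩
    · rw [h] at hv; simp at hv
    · exact Or.inr ⟨_, h, by simp⟩
  have h2 := (Finset.card_le_card h1).trans (Finset.card_union_le _ _)
  have h3 : ((Finset.Iio i).image σ).card ≤ i := by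
    refine Finset.card_image_le.trans ?_
    simp
  rw [Fin.card_Ioi] at h2
  unfold hgt
  omega

lemma hgt_step {n : ℕ} (σ : Equiv.Perm (Fin n)) (hσ : Avoids σ pattern132) (i k : Fin n)
    (hik : (i : ℕ) + 1 = k) : hgt σ i ≤ hgt σ k + 1 := by
  have hlt : i < k := by rw [Fin.lt_def]; omega
  have h1 : (univ.filter (fun v : Fin n => σ i < v ∧ i < σ.symm v)) ⊆
      insert (σ k) (univ.filter (fun v : Fin n => σ k < v ∧ k < σ.symm v)) := by
    intro v hv
    simp only [Finset.mem_insert, Finset.mem_filter, Finset.mem_univ, true_and] at hv ⊢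
    by_cases hvk : v = σ k
    · exact Or.inl hvk
    · right
      obtain ⟨l, rfl⟩ := σ.surjective v
      simp only [Equiv.symm_apply_apply] at hv ⊢
      have hlk : l ≠ k := fun h => hvk (by rw [h])
      have hkl : k < l := by
        have := hv.2
        rw [Fin.lt_def] at this ⊢
        have h4 : (l : ℕ) ≠ k := fun h => hlk (Fin.ext h)
        omega
      refine ⟨?_, hkl⟩
      by_contra hc
      have hc' : σ l < σ k := lt_of_le_of_ne (not_lt.mp hc) hvk
      apply hσ
      refine ⟨![i, k, l], ?_, ?_⟩
      · rw [Fin.strictMono_iff_lt_succ]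
        intro a
        fin_cases a
        · simpa using hlt
        · simpa using hkl
      · have h01 : σ i < σ k := hv.1.trans hc'
        intro a b
        have p0 : pattern132 0 = 0 := by decide
        have p1 : pattern132 1 = 2 := by decide
        have p2 : pattern132 2 = 1 := by decide
        fin_cases a <;> fin_cases b <;>
          simp [p0, p1, p2, hv.1, hc', h01, hv.1.le, hc'.le, h01.le]
  exact (Finset.card_le_card h1).trans (Finset.card_insert_le _ _)

/-- partial sums -/
def psum {n : ℕ} (σ : Equiv.Perm (Fin n)) (i : ℕ) : ℕ :=
  if h : i - 1 < n ∧ 0 < i then hgt σ ⟨i - 1, h.1⟩ + i else if i = 0 then 0 else n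

lemma psum_mono {n : ℕ} (σ : Equiv.Perm (Fin n)) (hσ : Avoids σ pattern132) :
    Monotone (psum σ) := by
  apply monotone_nat_of_le_succ
  intro i
  unfold psum
  by_cases h0 : i = 0
  · simp [h0]
  by_cases h1 : i < n
  · have := hgt_step σ hσ ⟨i - 1, by omega⟩ ⟨i, h1⟩ (by simp; omega)
    rw [dif_pos ⟨by omega, by omega⟩, dif_pos ⟨by omega, by omega⟩]
    simp only [Nat.add_sub_cancel]
    omega
  · rw [dif_neg (c := i + 1 - 1 < n ∧ 0 < i + 1) (by omega)]
    simp only [Nat.add_eq_zero_iff, one_ne_zero, and_false, if_false]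
    split_ifs with h2
    · have := hgt_le σ ⟨i - 1, h2.1⟩
      simp at this
      omega
    · omega

lemma psum_succ {n : ℕ} (σ : Equiv.Perm (Fin n)) (i : Fin n) :
    psum σ (i + 1) = hgt σ i + (i + 1) := by
  unfold psum
  rw [dif_pos ⟨by have := i.2; omega, by omega⟩]
  rfl

lemma psum_n {n : ℕ} (σ : Equiv.Perm (Fin n)) : psum σ n = n := by
  rcases n with _ | m
  · simp [psum]
  · have h := psum_succ σ (Fin.last m)
    have h2 := hgt_le σ (Fin.last m)
    simp at h h2
    rw [h, h2]
    omega

lemma psum_zero {n : ℕ} (σ : Equiv.Perm (Fin n)) : psum σ 0 = 0 := by simp [psum]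

def inc {n : ℕ} (σ : Equiv.Perm (Fin n)) (i : Fin n) : ℕ := psum σ (i + 1) - psum σ i

lemma inc_sum {n : ℕ} (σ : Equiv.Perm (Fin n)) (hσ : Avoids σ pattern132) (j : ℕ) (hj : j ≤ n) :
    ∑ i : Fin n, (if (i : ℕ) < j then inc σ i else 0) = psum σ j := by
  have h1 : ∑ i : Fin n, (if (i : ℕ) < j then inc σ i else 0) =
      ∑ i ∈ range n, if i < j then psum σ (i + 1) - psum σ i else 0 := by
    rw [Finset.sum_range]
    rfl
  rw [h1, ← Finset.sum_filter]
  have h2 : (range n).filter (fun i => i < j) = range j := by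
    ext i; simp; omega
  rw [h2, Finset.sum_range_tsub (psum_mono σ hσ), psum_zero]
  simp

lemma inc_inj {n : ℕ} (σ τ : Equiv.Perm (Fin n)) (hσ : Avoids σ pattern132)
    (hτ : Avoids τ pattern132) (h : inc σ = inc τ) : σ = τ := by
  apply hgt_inj
  intro i
  have h1 := inc_sum σ hσ (i + 1) i.2
  have h2 := inc_sum τ hτ (i + 1) i.2
  rw [h, h2, psum_succ, psum_succ] at h1
  omega

def TT (n j s : ℕ) : Finset (Fin n → ℕ) :=
  (Fintype.piFinset (fun _ : Fin n => range (n + 1))).filter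
    (fun u => ∑ i, u i = n ∧ s ≤ ∑ i : Fin n, (if (i : ℕ) < j then u i else 0))

lemma geom_bound (r : ℝ) (h0 : 0 ≤ r) (h1 : r < 1) (m : ℕ) :
    ∑ u ∈ range m, r ^ u ≤ (1 - r)⁻¹ := by
  rw [← tsum_geometric_of_lt_one h0 h1]
  exact (summable_geometric_of_lt_one h0 h1).sum_le_tsum _ (fun i _ => pow_nonneg h0 i)

lemma TT_card (n j s : ℕ) (hj : j ≤ n) (x : ℝ) (hx0 : 0 ≤ x) (hx1 : x < 1) :
    ((TT n j s).card : ℝ) * ((1 / 4) ^ n * (1 + x) ^ s) ≤ ((1 - x)⁻¹) ^ j := by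
  set w : Fin n → ℕ → ℝ := fun i u =>
    (1 / 2) ^ (u + 1) * (if (i : ℕ) < j then (1 + x) ^ u else 1) with hw
  have hwpos : ∀ i u, 0 ≤ w i u := by
    intro i u
    simp only [hw]
    split_ifs <;> positivity
  calc ((TT n j s).card : ℝ) * ((1 / 4) ^ n * (1 + x) ^ s)
      = ∑ u ∈ TT n j s, ((1 / 4) ^ n * (1 + x) ^ s) := by simp
    _ ≤ ∑ u ∈ TT n j s, ∏ i, w i (u i) := by
        apply Finset.sum_le_sum
        intro u hu
        simp only [TT, Finset.mem_filter] at hu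
        obtain ⟨_, hu1, hu2⟩ := hu
        have e1 : ∏ i, w i (u i) = (1 / 4) ^ n *
            (1 + x) ^ (∑ i : Fin n, (if (i : ℕ) < j then u i else 0)) := by
          simp only [hw]
          rw [Finset.prod_mul_distrib]
          congr 1
          · rw [Finset.prod_pow_eq_pow_sum, Finset.sum_add_distrib, hu1]
            simp only [Finset.sum_const, Finset.card_univ, Fintype.card_fin, smul_eq_mul, mul_one]
            rw [← two_mul, pow_mul]
            norm_num
          · rw [← Finset.prod_pow_eq_pow_sum]
            apply Finset.prod_congr rfl
            intro i _
            split_ifs <;> simp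
        rw [e1]
        gcongr
        linarith
    _ ≤ ∑ u ∈ Fintype.piFinset (fun _ : Fin n => range (n + 1)), ∏ i, w i (u i) := by
        apply Finset.sum_le_sum_of_subset_of_nonneg (Finset.filter_subset _ _)
        intro u _ _
        exact Finset.prod_nonneg (fun i _ => hwpos _ _)
    _ = ∏ i : Fin n, ∑ u ∈ range (n + 1), w i u := by
        rw [Finset.prod_univ_sum]
    _ ≤ ∏ i : Fin n, (if (i : ℕ) < j then (1 - x)⁻¹ else 1) := by
        apply Finset.prod_le_prod
        · intro i _
          exact Finset.sum_nonneg (fun u _ => hwpos _ _)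
        · intro i _
          simp only [hw]
          split_ifs with hij
          · have h1 := geom_bound ((1 + x) / 2) (by linarith) (by linarith) (n + 1)
            have h2 : ∀ u : ℕ, (1 / 2 : ℝ) ^ (u + 1) * (1 + x) ^ u = 1 / 2 * ((1 + x) / 2) ^ u := by
              intro u
              rw [div_pow, div_pow, one_pow, pow_succ]
              field_simp
            simp only [h2]
            rw [← Finset.mul_sum]
            have h3 : (1 - x)⁻¹ = 1 / 2 * (1 - (1 + x) / 2)⁻¹ := by
              have : (1 - x) ≠ 0 := by linarith
              have h4 : 1 - (1 + x) / 2 = (1 - x) / 2 := by ring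
              rw [h4]
              field_simp
            rw [h3]
            gcongr
          · have h1 := geom_bound (1 / 2) (by norm_num) (by norm_num) (n + 1)
            simp only [mul_one, pow_succ]
            rw [← Finset.sum_mul]
            norm_num at h1 ⊢
            linarith
    _ = ((1 - x)⁻¹) ^ j := by
        have := Finset.prod_range (fun i : ℕ => if i < j then (1 - x)⁻¹ else (1 : ℝ)) (n := n)
        rw [← this, ← Finset.prod_filter]
        have h2 : (range n).filter (fun i => i < j) = range j := by
          ext i; simp; omega
        rw [h2]
        simp

lemma TT_bound (n j D : ℕ) (hj : j ≤ n) (hD : D ≤ n) (hn : 0 < n) :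
    ((TT n j (j + D)).card : ℝ) ≤ 4 ^ n * exp (-((D : ℝ) ^ 2 / (32 * n))) := by
  have hn' : (0 : ℝ) < n := by exact_mod_cast hn
  have hD' : (D : ℝ) ≤ n := by exact_mod_cast hD
  have hj' : (j : ℝ) ≤ n := by exact_mod_cast hj
  obtain ⟨x, hx⟩ : ∃ x : ℝ, x = D / (8 * n) := ⟨_, rfl⟩
  have hx0 : 0 ≤ x := by rw [hx]; positivity
  have hx1 : x ≤ 1 / 8 := by
    rw [hx, div_le_iff₀ (by positivity)]; linarith
  have hDx : (D : ℝ) = x * (8 * n) := by rw [hx]; field_simp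
  have h := TT_card n j (j + D) hj x hx0 (by linarith)
  have hK0 : (0 : ℝ) ≤ ((TT n j (j + D)).card : ℝ) := Nat.cast_nonneg _
  generalize ((TT n j (j + D)).card : ℝ) = K at h hK0 ⊢
  have e1 : exp (x / 2) ≤ 1 + x := by
    have h1 := Real.add_one_le_exp (-(x / 2))
    have h2 : exp (x / 2) * exp (-(x / 2)) = 1 := by rw [← Real.exp_add]; simp
    have h3 := Real.exp_pos (x / 2)
    have h4 : exp (x / 2) * (1 - x / 2) ≤ 1 := by
      rw [← h2]; gcongr; linarith
    nlinarith
  have e2 : exp (-(2 * x ^ 2)) ≤ (1 + x) * (1 - x) := by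
    have h1 := Real.add_one_le_exp (2 * x ^ 2)
    have h2 : exp (2 * x ^ 2) * exp (-(2 * x ^ 2)) = 1 := by rw [← Real.exp_add]; simp
    have h3 := Real.exp_pos (-(2 * x ^ 2))
    have h4 : (1 + 2 * x ^ 2) * exp (-(2 * x ^ 2)) ≤ 1 := by
      rw [← h2]; gcongr; linarith
    have h5 : x ^ 2 ≤ 1 / 64 := by nlinarith
    have h6 : 1 ≤ (1 + 2 * x ^ 2) * ((1 + x) * (1 - x)) := by nlinarith [sq_nonneg x]
    have h7 : 0 < 1 + 2 * x ^ 2 := by positivity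
    exact le_of_mul_le_mul_left (h4.trans h6) h7
  have e3 : exp ((D : ℝ) ^ 2 / (32 * n)) ≤ (1 + x) ^ (j + D) * (1 - x) ^ j := by
    calc exp ((D : ℝ) ^ 2 / (32 * n)) ≤ exp (j * (-(2 * x ^ 2)) + D * (x / 2)) := by
          apply Real.exp_le_exp.mpr
          have : (D : ℝ) ^ 2 / (32 * n) = 2 * x ^ 2 * n := by
            rw [hDx]; field_simp; ring
          rw [this, hDx]
          nlinarith [mul_le_mul_of_nonneg_left hj' (sq_nonneg x)]
      _ = exp (-(2 * x ^ 2)) ^ j * exp (x / 2) ^ D := by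
          rw [Real.exp_add, Real.exp_nat_mul, Real.exp_nat_mul]
      _ ≤ ((1 + x) * (1 - x)) ^ j * (1 + x) ^ D := by
          have h8 : 0 ≤ (1 + x) * (1 - x) := (Real.exp_pos _).le.trans e2
          gcongr
      _ = _ := by rw [mul_pow, pow_add]; ring
  have hq : 0 < (1 - x) ^ j := by
    have : 0 < 1 - x := by linarith
    positivity
  rw [Real.exp_neg]
  rw [← div_eq_mul_inv, le_div_iff₀ (Real.exp_pos _)]
  rw [inv_pow, ← one_div, le_div_iff₀ hq] at h
  have h4 : (0 : ℝ) < 4 ^ n := by positivity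
  calc K * exp ((D : ℝ) ^ 2 / (32 * n))
      ≤ K * ((1 + x) ^ (j + D) * (1 - x) ^ j) := by gcongr
    _ = 4 ^ n * (K * ((1 / 4) ^ n * (1 + x) ^ (j + D)) * (1 - x) ^ j) := by
        rw [div_pow, one_pow]; field_simp
    _ ≤ 4 ^ n * 1 := mul_le_mul_of_nonneg_left h h4.le
    _ = 4 ^ n := by ring

lemma natcard_le_of_inj {A B : Type*} (T : Finset B) (f : A → B) (hmem : ∀ a, f a ∈ T)
    (hinj : ∀ a b, f a = f b → a = b) : Nat.card A ≤ T.card := by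
  rw [← Nat.card_eq_finsetCard]
  apply Nat.card_le_card_of_injective (fun a => (⟨f a, hmem a⟩ : {x // x ∈ T}))
  intro a b h
  exact hinj a b (congrArg Subtype.val h)

attribute [irreducible] TT

lemma Q_bound (n : ℕ) (j k : ℤ) (d : ℝ) (hd : 0 ≤ d) (hdn : d ≤ (n : ℝ) + 1 - j - k) :
    (QcountZ n j k : ℝ) ≤ 4 ^ n * exp (-(d ^ 2 / (32 * n))) := by
  unfold QcountZ
  by_cases hne : Nonempty {σ : Equiv.Perm (Fin n) //
    Avoids σ pattern132 ∧ ∃ i : Fin n, ((i : ℕ) : ℤ) + 1 = j ∧ ((σ i : ℕ) : ℤ) + 1 = k}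
  swap
  · rw [not_nonempty_iff] at hne
    rw [Nat.card_of_isEmpty]
    simp only [Nat.cast_zero]
    positivity
  obtain ⟨σ0, -, i0, hi0, hk0⟩ := hne
  have hi0n := i0.2
  have hDZ : 0 ≤ (n : ℤ) + 1 - j - k := by
    have : (0 : ℝ) ≤ (((n : ℤ) + 1 - j - k : ℤ) : ℝ) := by push_cast; linarith
    exact_mod_cast this
  obtain ⟨D, hD⟩ := Int.eq_ofNat_of_zero_le hDZ
  have hDd : d ≤ D := by
    have : (((n : ℤ) + 1 - j - k : ℤ) : ℝ) = ((D : ℤ) : ℝ) := by rw [hD]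
    push_cast at this
    linarith
  have hq1 : (i0 : ℕ) + 1 ≤ n := hi0n
  have hq2 : D ≤ n := by omega
  have hq3 : 0 < n := by omega
  have hb := TT_bound n (i0 + 1) D hq1 hq2 hq3
  have hcard : Nat.card {σ : Equiv.Perm (Fin n) //
      Avoids σ pattern132 ∧ ∃ i : Fin n, ((i : ℕ) : ℤ) + 1 = j ∧ ((σ i : ℕ) : ℤ) + 1 = k} ≤
      (TT n (i0 + 1) (i0 + 1 + D)).card := by
    have hmem : ∀ σ : {σ : Equiv.Perm (Fin n) //
        Avoids σ pattern132 ∧ ∃ i : Fin n, ((i : ℕ) : ℤ) + 1 = j ∧ ((σ i : ℕ) : ℤ) + 1 = k},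
        inc σ.1 ∈ TT n (i0 + 1) (i0 + 1 + D) := by
      rintro ⟨σ, hσ, i, hi, hk⟩
      have hii : i = i0 := Fin.ext (by omega)
      subst hii
      have hs := inc_sum σ hσ n le_rfl
      simp only [Fin.is_lt, if_true] at hs
      rw [psum_n] at hs
      simp only [TT, Finset.mem_filter, Fintype.mem_piFinset, Finset.mem_range]
      refine ⟨fun l => ?_, hs, ?_⟩
      · have := Finset.single_le_sum (f := inc σ) (fun l _ => Nat.zero_le _) (Finset.mem_univ l)
        omega
      · rw [inc_sum σ hσ (i + 1) i.2, psum_succ]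
        have := hgt_ge σ i
        omega
    refine natcard_le_of_inj _ (fun σ => inc σ.1) hmem ?_
    intro σ τ h
    have h' : inc σ.1 = inc τ.1 := h
    exact Subtype.ext (inc_inj _ _ σ.2.1 τ.2.1 h')
  calc _ ≤ ((TT n (i0 + 1) (i0 + 1 + D)).card : ℝ) := Nat.cast_le.mpr hcard
    _ ≤ 4 ^ n * exp (-((D : ℝ) ^ 2 / (32 * n))) := hb
    _ ≤ 4 ^ n * exp (-(d ^ 2 / (32 * n))) := by
        have h4 : (0 : ℝ) ≤ 4 ^ n := by positivity
        refine mul_le_mul_of_nonneg_left ?_ h4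
        apply Real.exp_le_exp.mpr
        apply neg_le_neg
        gcongr

lemma ratio_bound (n : ℕ) (hn : 0 < n) (j k : ℤ) (d : ℝ) (hd : 0 ≤ d)
    (hdn : d ≤ (n : ℝ) + 1 - j - k) :
    (QcountZ n j k : ℝ) / (catalan n : ℝ) ≤ 4 * (n : ℝ) ^ 2 * exp (-(d ^ 2 / (32 * n))) := by
  have hQ := Q_bound n j k d hd hdn
  have h1 := Nat.four_pow_le_two_mul_self_mul_centralBinom n hn
  rw [← succ_mul_catalan_eq_centralBinom] at h1
  have h2 : (4 : ℝ) ^ n ≤ 2 * n * ((n + 1) * catalan n) := by exact_mod_cast h1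
  have hn' : (1 : ℝ) ≤ n := by exact_mod_cast hn
  have hc : (0 : ℝ) < catalan n := by
    by_contra hc
    have h4 : (0 : ℝ) < 4 ^ n := by positivity
    have : (catalan n : ℝ) = 0 := le_antisymm (not_lt.mp hc) (Nat.cast_nonneg _)
    rw [this] at h2
    linarith [h2]
  rw [div_le_iff₀ hc]
  calc (QcountZ n j k : ℝ) ≤ 4 ^ n * exp (-(d ^ 2 / (32 * n))) := hQ
    _ ≤ (2 * n * ((n + n) * catalan n)) * exp (-(d ^ 2 / (32 * n))) := by
        gcongr
        refine h2.trans ?_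
        gcongr
    _ = _ := by ring

lemma ev_small (b β : ℝ) (hb : 0 < b) (hβ : 0 < β) :
    ∀ᶠ n : ℕ in atTop, 4 * (n : ℝ) ^ 2 * exp (-(b * (n : ℝ) ^ β)) < 1 := by
  have h1 := tendsto_rpow_mul_exp_neg_mul_atTop_nhds_zero (2 / β) b hb
  have h2 : Tendsto (fun n : ℕ => (n : ℝ) ^ β) atTop atTop :=
    (tendsto_rpow_atTop hβ).comp tendsto_natCast_atTop_atTop
  have h3 := (h1.comp h2).eventually (gt_mem_nhds (show (0 : ℝ) < 1 / 4 by norm_num))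
  filter_upwards [h3] with n hn
  simp only [Function.comp] at hn
  have h4 : ((n : ℝ) ^ β) ^ (2 / β) = (n : ℝ) ^ 2 := by
    rw [← Real.rpow_mul (Nat.cast_nonneg n), mul_div_cancel₀ _ hβ.ne']
    exact Real.rpow_two _
  rw [h4, neg_mul] at hn
  linarith

/-- Exponential decay of `Q_n`: (i) for `a + b < 1` the ratio
`Q_n(⌊an - cn^α⌋, ⌊bn - cn^α⌋)/C_n` is eventually smaller than `ε^n` for some
`ε ∈ (0,1)`; (ii) for `a + b = 1`, `c > 0` and `1/2 < α < 1` it is eventually smaller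
than `ε^{n^{2α-1}}`. -/
theorem Qcount_exponential_decay :
    (∀ a b : ℝ, 0 < a → a < 1 → 0 < b → b < 1 → a + b < 1 →
      ∀ c : ℝ, ∀ α : ℝ, 0 < α → α < 1 →
        ∃ ε : ℝ, 0 < ε ∧ ε < 1 ∧ ∃ N : ℕ, ∀ n : ℕ, N < n →
          (QcountZ n ⌊a * n - c * (n : ℝ) ^ α⌋ ⌊b * n - c * (n : ℝ) ^ α⌋ : ℝ) /
              (catalan n : ℝ) < ε ^ n) ∧
    (∀ a : ℝ, 0 < a → a < 1 → ∀ c : ℝ, 0 < c → ∀ α : ℝ, 1 / 2 < α → α < 1 →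
      ∃ ε : ℝ, 0 < ε ∧ ε < 1 ∧ ∃ N : ℕ, ∀ n : ℕ, N < n →
        (QcountZ n ⌊a * n - c * (n : ℝ) ^ α⌋ ⌊(1 - a) * n - c * (n : ℝ) ^ α⌋ : ℝ) /
            (catalan n : ℝ) < ε ^ ((n : ℝ) ^ (2 * α - 1))) := by
  constructor
  · intro a b ha ha1 hb hb1 hab c α hα hα1
    obtain ⟨δ, hδ⟩ : ∃ δ : ℝ, δ = (1 - a - b) / 2 := ⟨_, rfl⟩
    have hδ0 : 0 < δ := by rw [hδ]; linarith
    refine ⟨exp (-(δ ^ 2 / 64)), Real.exp_pos _, ?_, ?_⟩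
    · rw [Real.exp_lt_one_iff]
      have : 0 < δ ^ 2 / 64 := by positivity
      linarith
    have hE1 := ev_small (δ ^ 2 / 64) 1 (by positivity) one_pos
    have hE2 : ∀ᶠ n : ℕ in atTop, 2 * |c| / δ < (n : ℝ) ^ (1 - α) :=
      ((tendsto_rpow_atTop (show 0 < 1 - α by linarith)).comp
        tendsto_natCast_atTop_atTop).eventually_gt_atTop _
    obtain ⟨N, hN⟩ := eventually_atTop.mp (hE1.and hE2)
    refine ⟨N, fun n hn => ?_⟩
    obtain ⟨h1, h2⟩ := hN n hn.le
    have hn0 : 0 < n := by omega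
    have hnr : (0 : ℝ) < n := by exact_mod_cast hn0
    have hnα : 0 < (n : ℝ) ^ α := Real.rpow_pos_of_pos hnr _
    have hmul : (n : ℝ) ^ (1 - α) * (n : ℝ) ^ α = n := by
      rw [← Real.rpow_add hnr]; simp
    have h3 : 2 * |c| * (n : ℝ) ^ α < δ * n := by
      rw [div_lt_iff₀ hδ0] at h2
      calc 2 * |c| * (n : ℝ) ^ α < (n : ℝ) ^ (1 - α) * δ * (n : ℝ) ^ α := by gcongr
        _ = δ * ((n : ℝ) ^ (1 - α) * (n : ℝ) ^ α) := by ring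
        _ = δ * n := by rw [hmul]
    have h4 : -|c| * (n : ℝ) ^ α ≤ c * (n : ℝ) ^ α := by
      gcongr
      exact neg_abs_le c
    have f1 := Int.floor_le (a * n - c * (n : ℝ) ^ α)
    have f2 := Int.floor_le (b * n - c * (n : ℝ) ^ α)
    have hab2 : a * n + b * n + 2 * (δ * n) = n := by rw [hδ]; ring
    have hr := ratio_bound n hn0 ⌊a * n - c * (n : ℝ) ^ α⌋ ⌊b * n - c * (n : ℝ) ^ α⌋ (δ * n)
      (by positivity) (by linarith)
    refine lt_of_le_of_lt hr ?_
    have e1 : exp (-((δ * n) ^ 2 / (32 * n))) = exp (-(δ ^ 2 / 64 * n)) * exp (-(δ ^ 2 / 64)) ^ n := by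
      rw [← Real.exp_nat_mul, ← Real.exp_add]
      congr 1
      field_simp
      ring
    rw [e1, ← mul_assoc]
    rw [Real.rpow_one] at h1
    exact mul_lt_of_lt_one_left (by positivity) h1
  · intro a ha ha1 c hc α hα hα1
    refine ⟨exp (-(c ^ 2 / 16)), Real.exp_pos _, ?_, ?_⟩
    · rw [Real.exp_lt_one_iff]
      have : 0 < c ^ 2 / 16 := by positivity
      linarith
    have hE1 := ev_small (c ^ 2 / 16) (2 * α - 1) (by positivity) (by linarith)
    obtain ⟨N, hN⟩ := eventually_atTop.mp hE1
    refine ⟨N, fun n hn => ?_⟩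
    have h1 := hN n hn.le
    have hn0 : 0 < n := by omega
    have hnr : (0 : ℝ) < n := by exact_mod_cast hn0
    have hnα : 0 < (n : ℝ) ^ α := Real.rpow_pos_of_pos hnr _
    have f1 := Int.floor_le (a * n - c * (n : ℝ) ^ α)
    have f2 := Int.floor_le ((1 - a) * n - c * (n : ℝ) ^ α)
    have hr := ratio_bound n hn0 ⌊a * n - c * (n : ℝ) ^ α⌋ ⌊(1 - a) * n - c * (n : ℝ) ^ α⌋
      (2 * c * (n : ℝ) ^ α) (by positivity) (by linarith)
    refine lt_of_le_of_lt hr ?_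
    have hp : ((n : ℝ) ^ α) ^ 2 = (n : ℝ) ^ (2 * α - 1) * n := by
      rw [← Real.rpow_natCast, ← Real.rpow_mul hnr.le, ← Real.rpow_add_one hnr.ne']
      congr 1
      push_cast
      ring
    have e1 : exp (-((2 * c * (n : ℝ) ^ α) ^ 2 / (32 * n))) =
        exp (-(c ^ 2 / 16 * (n : ℝ) ^ (2 * α - 1))) *
          exp (-(c ^ 2 / 16)) ^ ((n : ℝ) ^ (2 * α - 1)) := by
      rw [← Real.exp_mul, ← Real.exp_add]
      congr 1
      rw [mul_pow, hp]
      field_simp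
      ring
    rw [e1, ← mul_assoc]
    exact mul_lt_of_lt_one_left (by positivity) h1
end
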